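/- arXiv:0903.5170 — 2 statements merged into one kernel-verified Lean document; each statement's English description precedes it below -/
import Mathlib

section
/- Let Λ = KQ/I where Q is the quiver with vertices 1, 2, 3, 4 and arrows α: 1→2, β: 2→3, γ: 3→4, δ: 4→1, and I = ⟨αβγδαβ, γδαβγδ⟩. Then the indecomposable projective right Λ-modules e_2Λ and e_4Λ are injective, e_3Λ is not injective (so Λ is not self-injective), and there are injective resolutions 0 → e_1Λ → I(2) → I(4) → I(3) → 0 and 0 → e_3Λ → I(4) → I(2) → I(1) → 0, where I(j) is the indecomposable injective right Λ-module corresponding to the vertex j; consequently the injective dimension of Λ as a right Λ-module is 2. -/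
/-! ## Monomial algebras `Λ = KQ/I` presented by quiver and monomial relations -/

/-- Generators (vertices and arrows) for the presentation of the path algebra `KQ`. -/
inductive PAGen (V E : Type) : Type
  | vert : V → PAGen V E
  | arr : E → PAGen V E

/-- The defining relations of the monomial algebra `Λ = KQ/I`: the trivial paths are
orthogonal idempotents summing to `1`, arrows compose according to the quiver structure,
and the monomial relations in `ρ` vanish. -/
inductive PARel (K : Type) [Field K] (V E : Type) [Fintype V] [DecidableEq V]
    (s t : E → V) (ρ : Set (List E)) :
    FreeAlgebra K (PAGen V E) → FreeAlgebra K (PAGen V E) → Prop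
  | vert (i j : V) :
      PARel K V E s t ρ (FreeAlgebra.ι K (PAGen.vert i) * FreeAlgebra.ι K (PAGen.vert j))
        (if i = j then FreeAlgebra.ι K (PAGen.vert i) else 0)
  | one : PARel K V E s t ρ (∑ i : V, FreeAlgebra.ι K (PAGen.vert i)) 1
  | src (e : E) (i : V) :
      PARel K V E s t ρ (FreeAlgebra.ι K (PAGen.vert i) * FreeAlgebra.ι K (PAGen.arr e))
        (if i = s e then FreeAlgebra.ι K (PAGen.arr e) else 0)
  | tgt (e : E) (i : V) :
      PARel K V E s t ρ (FreeAlgebra.ι K (PAGen.arr e) * FreeAlgebra.ι K (PAGen.vert i))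
        (if i = t e then FreeAlgebra.ι K (PAGen.arr e) else 0)
  | rel (p : List E) : p ∈ ρ →
      PARel K V E s t ρ ((p.map fun e => FreeAlgebra.ι K (PAGen.arr e)).prod) 0

/-- The monomial algebra `Λ = KQ/I` determined by the quiver `(V, E, s, t)` and the
set `ρ` of monomial relations. -/
abbrev MonAlg (K : Type) [Field K] (V E : Type) [Fintype V] [DecidableEq V]
    (s t : E → V) (ρ : Set (List E)) : Type :=
  RingQuot (PARel K V E s t ρ)

/-- The trivial path `e_i` at the vertex `i`, as an element of `Λ = KQ/I`. -/
noncomputable def vtxEl (K : Type) [Field K] (V E : Type) [Fintype V] [DecidableEq V]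
    (s t : E → V) (ρ : Set (List E)) (i : V) : MonAlg K V E s t ρ :=
  RingQuot.mkAlgHom K (PARel K V E s t ρ) (FreeAlgebra.ι K (PAGen.vert i))

/-- The arrow `e`, as an element of `Λ = KQ/I`. -/
noncomputable def arrEl (K : Type) [Field K] (V E : Type) [Fintype V] [DecidableEq V]
    (s t : E → V) (ρ : Set (List E)) (e : E) : MonAlg K V E s t ρ :=
  RingQuot.mkAlgHom K (PARel K V E s t ρ) (FreeAlgebra.ι K (PAGen.arr e))

/-- The path with list of arrows `p`, as an element of `Λ = KQ/I`. -/
noncomputable def pathEl (K : Type) [Field K] (V E : Type) [Fintype V] [DecidableEq V]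
    (s t : E → V) (ρ : Set (List E)) (p : List E) : MonAlg K V E s t ρ :=
  (p.map (arrEl K V E s t ρ)).prod

/-! ## Homological notions: injective/projective dimension, Gorenstein algebras,
simple modules and injective envelopes attached to vertices -/

/-- `InjDimLE R n M`: the `R`-module `M` has injective dimension at most `n`. -/
def InjDimLE (R : Type) [Ring R] : ℕ → ModuleCat.{0} R → Prop
  | 0, M => Module.Injective R M
  | n + 1, M => ∃ (I : ModuleCat.{0} R) (f : M →ₗ[R] I), Module.Injective R I ∧
      Function.Injective f ∧ InjDimLE R n (ModuleCat.of R (I ⧸ LinearMap.range f))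

/-- `ProjDimLE R n M`: the `R`-module `M` has projective dimension at most `n`. -/
def ProjDimLE (R : Type) [Ring R] : ℕ → ModuleCat.{0} R → Prop
  | 0, M => Module.Projective R M
  | n + 1, M => ∃ (P : ModuleCat.{0} R) (f : P →ₗ[R] M), Module.Projective R P ∧
      Function.Surjective f ∧ ProjDimLE R n (ModuleCat.of R (LinearMap.ker f))

/-- A ring is Gorenstein if it has finite injective dimension as a left and as a right
module over itself (right modules are left modules over the opposite ring). -/
def IsGorenstein (R : Type) [Ring R] : Prop :=
  (∃ n, InjDimLE R n (ModuleCat.of R R)) ∧ (∃ n, InjDimLE Rᵐᵒᵖ n (ModuleCat.of Rᵐᵒᵖ R))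

/-- A submodule `N ≤ M` is superfluous: `X + N = M` forces `X = M`.  (Used to express
minimality of projective resolutions.) -/
def Superfluous {R M : Type} [Ring R] [AddCommGroup M] [Module R M]
    (N : Submodule R M) : Prop :=
  ∀ X : Submodule R M, X ⊔ N = ⊤ → X = ⊤

/-- A submodule `N ≤ M` is essential: it meets every nonzero submodule nontrivially. -/
def IsEssentialSub {R M : Type} [Ring R] [AddCommGroup M] [Module R M]
    (N : Submodule R M) : Prop :=
  ∀ N' : Submodule R M, N' ≠ ⊥ → N ⊓ N' ≠ ⊥

/-- `M` is (a copy of) the simple right `Λ`-module at the vertex with trivial path `e`: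
it is simple and `e` acts as the identity on some nonzero element. -/
def IsSimpleAt (Λ : Type) [Ring Λ] (e : Λ) (M : Type) [AddCommGroup M]
    [Module Λᵐᵒᵖ M] : Prop :=
  IsSimpleModule Λᵐᵒᵖ M ∧ ∃ x : M, x ≠ 0 ∧ MulOpposite.op e • x = x

/-- `M` is (a copy of) the indecomposable injective right `Λ`-module `I(j)` at the vertex
with trivial path `e`: it is injective with an essential simple submodule at that vertex. -/
def IsInjEnvAt (Λ : Type) [Ring Λ] (e : Λ) (M : Type) [AddCommGroup M]
    [Module Λᵐᵒᵖ M] : Prop :=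
  Module.Injective Λᵐᵒᵖ M ∧ ∃ N : Submodule Λᵐᵒᵖ M, IsEssentialSub N ∧ IsSimpleAt Λ e ↥N

/-! ## The quiver `Q` of Example 2.8: vertices `1, 2, 3, 4` (here `0, 1, 2, 3` : `Fin 4`),
arrows `α : 1→2, β : 2→3, γ : 3→4, δ : 4→1` (here `a0, a1, a2, a3`),
relations `I = ⟨αβγδαβ, γδαβγδ⟩`. -/

inductive QC : Type | a0 | a1 | a2 | a3

def sC : QC → Fin 4
  | .a0 => 0 | .a1 => 1 | .a2 => 2 | .a3 => 3

def tC : QC → Fin 4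
  | .a0 => 1 | .a1 => 2 | .a2 => 3 | .a3 => 0

def ρC : Set (List QC) :=
  {[QC.a0, QC.a1, QC.a2, QC.a3, QC.a0, QC.a1], [QC.a2, QC.a3, QC.a0, QC.a1, QC.a2, QC.a3]}

/-- The monomial algebra `Λ = KQ/I` of Example 2.8. -/
abbrev ΛC (K : Type) [Field K] : Type := MonAlg K (Fin 4) QC sC tC ρC

/-- The trivial path `e_i` in `Λ`. -/
noncomputable def eC (K : Type) [Field K] (i : Fin 4) : ΛC K :=
  vtxEl K (Fin 4) QC sC tC ρC i

/-- The indecomposable projective right `Λ`-module `e_iΛ`, as a right ideal. -/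
noncomputable def eRC (K : Type) [Field K] (i : Fin 4) : Submodule (ΛC K)ᵐᵒᵖ (ΛC K) :=
  Submodule.span (ΛC K)ᵐᵒᵖ {eC K i}

/-- The central element `z = αβγδ + βγδα + γδαβ + δαβγ` of `Λ`. -/
noncomputable def zC (K : Type) [Field K] : ΛC K :=
  pathEl K (Fin 4) QC sC tC ρC [QC.a0, QC.a1, QC.a2, QC.a3] +
  pathEl K (Fin 4) QC sC tC ρC [QC.a1, QC.a2, QC.a3, QC.a0] +
  pathEl K (Fin 4) QC sC tC ρC [QC.a2, QC.a3, QC.a0, QC.a1] +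
  pathEl K (Fin 4) QC sC tC ρC [QC.a3, QC.a0, QC.a1, QC.a2]

/-! ## Injective modules and injective dimension -/

section InjectiveDimension

variable {R : Type} [Ring R] {M N C I₀ I₁ I₂ : Type}
  [AddCommGroup M] [Module R M] [AddCommGroup N] [Module R N] [AddCommGroup C] [Module R C]
  [AddCommGroup I₀] [Module R I₀] [AddCommGroup I₁] [Module R I₁] [AddCommGroup I₂] [Module R I₂]

lemma Module.Injective.of_retract (hN : Module.Injective R N) (i : M →ₗ[R] N) (p : N →ₗ[R] M)
    (hpi : ∀ x, p (i x) = x) : Module.Injective R M where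
  out X Y _ _ _ _ f hf g := by
    obtain ⟨h, hh⟩ := hN.out f hf (i ∘ₗ g)
    exact ⟨p ∘ₗ h, fun x => by rw [LinearMap.comp_apply, hh, LinearMap.comp_apply, hpi]⟩

lemma Module.Injective.of_linearEquiv (hN : Module.Injective R N) (e : M ≃ₗ[R] N) :
    Module.Injective R M :=
  hN.of_retract e.toLinearMap e.symm.toLinearMap e.symm_apply_apply

lemma Module.Injective.prod (hM : Module.Injective R M) (hN : Module.Injective R N) :
    Module.Injective R (M × N) where
  out X Y _ _ _ _ f hf g := by
    obtain ⟨h₁, hh₁⟩ := hM.out f hf (LinearMap.fst R M N ∘ₗ g)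
    obtain ⟨h₂, hh₂⟩ := hN.out f hf (LinearMap.snd R M N ∘ₗ g)
    exact ⟨h₁.prod h₂, fun x => Prod.ext (hh₁ x) (hh₂ x)⟩

lemma LinearMap.exists_factor_of_surjective {p : M →ₗ[R] N} (hp : Function.Surjective p)
    (q : M →ₗ[R] C) (hq : LinearMap.ker p ≤ LinearMap.ker q) :
    ∃ q' : N →ₗ[R] C, ∀ x, q' (p x) = q x := by
  refine ⟨(LinearMap.ker p).liftQ q hq ∘ₗ (p.quotKerEquivOfSurjective hp).symm.toLinearMap,
    fun x => ?_⟩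
  have : (p.quotKerEquivOfSurjective hp).symm (p x) = (LinearMap.ker p).mkQ x := by
    rw [LinearEquiv.symm_apply_eq]; rfl
  simp [this]

lemma injDimLE_two_of_exact (f : M →ₗ[R] I₀) (g : I₀ →ₗ[R] I₁) (h : I₁ →ₗ[R] I₂)
    (hf : Function.Injective f) (hfg : Function.Exact f g) (hgh : Function.Exact g h)
    (hh : Function.Surjective h) (h₀ : Module.Injective R I₀) (h₁ : Module.Injective R I₁)
    (h₂ : Module.Injective R I₂) : InjDimLE R 2 (ModuleCat.of R M) := by
  have hker : LinearMap.range f = LinearMap.ker g := hfg.linearMap_ker_eq.symm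
  let g' : (I₀ ⧸ LinearMap.range f) →ₗ[R] I₁ := (LinearMap.range f).liftQ g hker.le
  have hrange : LinearMap.range g' = LinearMap.ker h := by
    rw [Submodule.range_liftQ, hgh.linearMap_ker_eq]
  have hinj : Function.Injective g' :=
    LinearMap.ker_eq_bot.1 (Submodule.ker_liftQ_eq_bot' _ _ hker)
  exact ⟨ModuleCat.of R I₀, f, h₀, hf, ModuleCat.of R I₁, g', h₁, hinj,
    h₂.of_linearEquiv ((Submodule.quotEquivOfEq _ _ hrange).trans
      (h.quotKerEquivOfSurjective hh))⟩

/-- If `M` has injective dimension at most one, then the cokernel of any embedding of `M` into an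
injective module is injective. -/
lemma InjDimLE.injective_of_exact (hM : InjDimLE R 1 (ModuleCat.of R M)) (f : M →ₗ[R] I₀)
    (p : I₀ →ₗ[R] C) (hf : Function.Injective f) (hfp : Function.Exact f p)
    (hp : Function.Surjective p) (h₀ : Module.Injective R I₀) : Module.Injective R C := by
  obtain ⟨I, j, hI, hj, hq⟩ := hM
  replace hq : Module.Injective R (I ⧸ LinearMap.range j) := hq
  obtain ⟨φ, hφ⟩ := hI.out f hf j
  obtain ⟨ψ, hψ⟩ := h₀.out j hj f
  have hker : ∀ x, p x = 0 → ∃ m, f m = x := fun x hx => (hfp x).1 hx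
  obtain ⟨φ', hφ'⟩ := LinearMap.exists_factor_of_surjective hp
    ((LinearMap.range j).mkQ ∘ₗ φ) fun x hx => by
      obtain ⟨m, rfl⟩ := hker x hx
      simp [hφ]
  obtain ⟨δ, hδ⟩ := LinearMap.exists_factor_of_surjective hp (ψ ∘ₗ φ - LinearMap.id)
    fun x hx => by
      obtain ⟨m, rfl⟩ := hker x hx
      simp [hφ, hψ]
  let ψ' : (I ⧸ LinearMap.range j) →ₗ[R] C := (LinearMap.range j).liftQ (p ∘ₗ ψ) <| by
    rintro _ ⟨m, rfl⟩
    simp [hψ, hfp.apply_apply_eq_zero]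
  have hcomp : ∀ c, ψ' (φ' c) = c + p (δ c) := fun c => by
    obtain ⟨x, rfl⟩ := hp c
    simp [hφ', hδ, ψ']
  refine ⟨fun X Y _ _ _ _ a ha h => ?_⟩
  obtain ⟨k, hk⟩ := hq.out a ha (φ' ∘ₗ h)
  obtain ⟨l, hl⟩ := h₀.out a ha (δ ∘ₗ h)
  exact ⟨ψ' ∘ₗ k - p ∘ₗ l, fun x => by simp [hk, hl, hcomp]⟩

end InjectiveDimension

/-! ## Paths in `Λ` -/

namespace CyclicQuiver

/-- The arrow of the cyclic quiver starting at the vertex `j mod 4`. -/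
def arrowFrom (j : ℕ) : QC :=
  match Fin.ofNat 4 j with
  | 0 => .a0 | 1 => .a1 | 2 => .a2 | 3 => .a3

lemma sC_arrowFrom (j : ℕ) : sC (arrowFrom j) = Fin.ofNat 4 j := by
  unfold arrowFrom
  generalize Fin.ofNat 4 j = x
  fin_cases x <;> rfl

lemma arrowFrom_sC (e : QC) : arrowFrom (sC e) = e := by
  cases e <;> rfl

lemma tC_val (e : QC) : (tC e : ℕ) = ((sC e : ℕ) + 1) % 4 := by
  cases e <;> rfl

lemma arrowFrom_congr {j j' : ℕ} (h : j % 4 = j' % 4) : arrowFrom j = arrowFrom j' := by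
  have : Fin.ofNat 4 j = Fin.ofNat 4 j' := Fin.ext h
  unfold arrowFrom
  rw [this]

lemma tC_arrowFrom (j : ℕ) : tC (arrowFrom j) = Fin.ofNat 4 (j + 1) := by
  apply Fin.ext
  rw [tC_val, sC_arrowFrom]
  simp [Fin.ofNat]

variable (K : Type) [Field K]

/-- The arrow starting at `j mod 4`, as an element of `Λ`. -/
noncomputable def arrow (j : ℕ) : ΛC K := arrEl K (Fin 4) QC sC tC ρC (arrowFrom j)

/-- The trivial path at `j mod 4`, as an element of `Λ`. -/
noncomputable def vertex (j : ℕ) : ΛC K := eC K (Fin.ofNat 4 j)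

/-- The path of length `l` starting at the vertex `s mod 4`. -/
noncomputable def path (s : ℕ) : ℕ → ΛC K
  | 0 => vertex K s
  | l + 1 => path s l * arrow K (s + l)

lemma vertex_congr {j j' : ℕ} (h : j % 4 = j' % 4) : vertex K j = vertex K j' := by
  have : Fin.ofNat 4 j = Fin.ofNat 4 j' := Fin.ext h
  rw [vertex, this, vertex]

lemma arrow_congr {j j' : ℕ} (h : j % 4 = j' % 4) : arrow K j = arrow K j' := by
  rw [arrow, arrowFrom_congr h, arrow]

lemma path_congr {s s' : ℕ} (h : s % 4 = s' % 4) (l : ℕ) : path K s l = path K s' l := by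
  induction l with
  | zero => exact vertex_congr K h
  | succ l ih => rw [path, path, ih, arrow_congr K (j' := s' + l) (by omega)]

lemma ofNat_eq_iff (i j : ℕ) : Fin.ofNat 4 i = Fin.ofNat 4 j ↔ i % 4 = j % 4 := by
  simp [Fin.ext_iff, Fin.ofNat]

lemma vertex_mul_vertex (i j : ℕ) :
    vertex K i * vertex K j = if i % 4 = j % 4 then vertex K i else 0 := by
  have h := RingQuot.mkAlgHom_rel K
    (PARel.vert (K := K) (s := sC) (t := tC) (ρ := ρC) (Fin.ofNat 4 i) (Fin.ofNat 4 j))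
  simp only [ofNat_eq_iff, map_mul] at h
  split_ifs at h ⊢ with hij
  · exact h
  · exact h.trans (map_zero _)

lemma vertex_mul_arrow (i j : ℕ) :
    vertex K i * arrow K j = if i % 4 = j % 4 then arrow K j else 0 := by
  have h := RingQuot.mkAlgHom_rel K
    (PARel.src (K := K) (s := sC) (t := tC) (ρ := ρC) (arrowFrom j) (Fin.ofNat 4 i))
  simp only [sC_arrowFrom, ofNat_eq_iff, map_mul] at h
  split_ifs at h ⊢ with hij
  · exact h
  · exact h.trans (map_zero _)

lemma arrow_mul_vertex (j i : ℕ) :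
    arrow K j * vertex K i = if i % 4 = (j + 1) % 4 then arrow K j else 0 := by
  have h := RingQuot.mkAlgHom_rel K
    (PARel.tgt (K := K) (s := sC) (t := tC) (ρ := ρC) (arrowFrom j) (Fin.ofNat 4 i))
  simp only [tC_arrowFrom, ofNat_eq_iff, map_mul] at h
  split_ifs at h ⊢ with hij
  · exact h
  · exact h.trans (map_zero _)

lemma sum_eC : ∑ i : Fin 4, eC K i = 1 := by
  have h := RingQuot.mkAlgHom_rel K
    (PARel.one (K := K) (V := Fin 4) (E := QC) (s := sC) (t := tC) (ρ := ρC))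
  rw [map_sum, map_one] at h
  exact h

lemma sum_vertex : vertex K 0 + vertex K 1 + vertex K 2 + vertex K 3 = 1 := by
  rw [← sum_eC, Fin.sum_univ_four]
  rfl

lemma path_mul_vertex (s l j : ℕ) :
    path K s l * vertex K j = if (s + l) % 4 = j % 4 then path K s l else 0 := by
  cases l with
  | zero => simp only [path, vertex_mul_vertex, add_zero]
  | succ l =>
    rw [path, mul_assoc, arrow_mul_vertex, mul_ite, mul_zero]
    exact if_congr (by omega) rfl rfl

lemma vertex_mul_path (j s l : ℕ) :
    vertex K j * path K s l = if j % 4 = s % 4 then path K s l else 0 := by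
  induction l with
  | zero =>
    rw [path, vertex_mul_vertex]
    split_ifs with h
    · exact vertex_congr K h
    · rfl
  | succ l ih => rw [path, ← mul_assoc, ih, ite_mul, zero_mul]

lemma path_mul_arrow (s l j : ℕ) :
    path K s l * arrow K j = if (s + l) % 4 = j % 4 then path K s (l + 1) else 0 := by
  split_ifs with h
  · rw [path, arrow_congr K h]
  · have hp : path K s l = path K s l * vertex K (s + l) := by simp [path_mul_vertex]
    rw [hp, mul_assoc, vertex_mul_arrow, if_neg h, mul_zero]

lemma path_succ' (s l : ℕ) : path K s (l + 1) = arrow K s * path K (s + 1) l := by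
  induction l with
  | zero => simp [path, vertex_mul_arrow, arrow_mul_vertex]
  | succ l ih => rw [path, ih, mul_assoc, path, show s + (l + 1) = s + 1 + l by omega]

lemma path_even_eq_zero {s l : ℕ} (hs : s % 2 = 0) (hl : 6 ≤ l) : path K s l = 0 := by
  obtain ⟨m, rfl⟩ := Nat.exists_eq_add_of_le hl
  induction m with
  | succ m ih => rw [show 6 + (m + 1) = (6 + m) + 1 by omega, path, ih (by omega), zero_mul]
  | zero =>
    rcases (by omega : s % 4 = 0 % 4 ∨ s % 4 = 2 % 4) with h | h
    · have hr := RingQuot.mkAlgHom_rel K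
        (PARel.rel (K := K) (s := sC) (t := tC) (ρ := ρC) _ (Or.inl rfl))
      simp only [List.map_cons, List.map_nil, List.prod_cons, List.prod_nil, map_mul,
        map_zero, mul_one] at hr
      rw [path_congr K h]
      simp only [path, mul_assoc]
      exact (congrArg (vertex K 0 * ·) hr).trans (mul_zero _)
    · have hr := RingQuot.mkAlgHom_rel K
        (PARel.rel (K := K) (s := sC) (t := tC) (ρ := ρC) _ (Or.inr rfl))
      simp only [List.map_cons, List.map_nil, List.prod_cons, List.prod_nil, map_mul,
        map_zero, mul_one] at hr
      rw [path_congr K h]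
      simp only [path, mul_assoc]
      exact (congrArg (vertex K 2 * ·) hr).trans (mul_zero _)

lemma path_eq_zero {s l : ℕ} (hl : 7 ≤ l) : path K s l = 0 := by
  rcases Nat.mod_two_eq_zero_or_one s with hs | hs
  · exact path_even_eq_zero K hs (by omega)
  · obtain ⟨m, rfl⟩ := Nat.exists_eq_add_of_le' hl
    rw [path_succ', path_even_eq_zero K (s := s + 1) (by omega) (by omega), mul_zero]

/-- The paths span `Λ`. -/
lemma mem_span_path (x : ΛC K) :
    x ∈ Submodule.span K (Set.range fun p : ℕ × ℕ => path K p.1 p.2) := by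
  set S := Submodule.span K (Set.range fun p : ℕ × ℕ => path K p.1 p.2) with hS
  have hpath : ∀ s l, path K s l ∈ S := fun s l => Submodule.subset_span ⟨(s, l), rfl⟩
  have hgen : ∀ z : ΛC K, (∀ s l, path K s l * z ∈ S) → ∀ y ∈ S, y * z ∈ S := by
    intro z hz y hy
    induction hy using Submodule.span_induction with
    | mem y hy => obtain ⟨p, rfl⟩ := hy; exact hz _ _
    | zero => rw [zero_mul]; exact S.zero_mem
    | add a b _ _ ha hb => rw [add_mul]; exact S.add_mem ha hb
    | smul c a _ ha => rw [smul_mul_assoc]; exact S.smul_mem c ha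
  have key : ∀ a : FreeAlgebra K (PAGen (Fin 4) QC), ∀ y ∈ S,
      y * RingQuot.mkAlgHom K (PARel K (Fin 4) QC sC tC ρC) a ∈ S := by
    intro a
    induction a using FreeAlgebra.induction with
    | grade0 c =>
      intro y hy
      rw [AlgHom.commutes, ← Algebra.commutes, ← Algebra.smul_def]
      exact S.smul_mem c hy
    | grade1 g =>
      refine hgen _ fun s l => ?_
      cases g with
      | vert j =>
        have h := path_mul_vertex K s l j
        have hj : vertex K j = RingQuot.mkAlgHom K (PARel K (Fin 4) QC sC tC ρC)
            (FreeAlgebra.ι K (PAGen.vert j)) := by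
          rw [vertex, Fin.ofNat_eq_cast, Fin.cast_val_eq_self]; rfl
        rw [← hj, h]
        split_ifs
        exacts [hpath _ _, S.zero_mem]
      | arr e =>
        have h := path_mul_arrow K s l (sC e)
        rw [arrow, arrowFrom_sC] at h
        change path K s l * arrEl K (Fin 4) QC sC tC ρC e ∈ S
        rw [h]
        split_ifs
        exacts [hpath _ _, S.zero_mem]
    | mul a b ha hb => intro y hy; rw [map_mul, ← mul_assoc]; exact hb _ (ha _ hy)
    | add a b ha hb => intro y hy; rw [map_add, mul_add]; exact S.add_mem (ha _ hy) (hb _ hy)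
  obtain ⟨a, rfl⟩ := RingQuot.mkAlgHom_surjective K (PARel K (Fin 4) QC sC tC ρC) x
  have h1 : (1 : ΛC K) ∈ S := by
    rw [← sum_vertex]
    exact S.add_mem (S.add_mem (S.add_mem (hpath 0 0) (hpath 1 0)) (hpath 2 0)) (hpath 3 0)
  simpa using key a 1 h1

@[elab_as_elim]
lemma path_induction {P : ΛC K → Prop} (hpath : ∀ s l, P (path K s l)) (hzero : P 0)
    (hadd : ∀ x y, P x → P y → P (x + y)) (hsmul : ∀ (c : K) x, P x → P (c • x)) (x : ΛC K) :
    P x := by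
  induction mem_span_path K x using Submodule.span_induction with
  | mem x hx => obtain ⟨p, rfl⟩ := hx; exact hpath _ _
  | zero => exact hzero
  | add a b _ _ ha hb => exact hadd _ _ ha hb
  | smul c a _ ha => exact hsmul _ _ ha

/-! ## Uniserial modules -/

/-- The underlying vector space of the uniserial right `Λ`-module of length `n` with top at the
vertex `i mod 4`; the `k`-th basis vector lies at the vertex `(i + k) mod 4`. -/
def Uni (K : Type) (_i n : ℕ) : Type := Fin n → K

namespace Uni

instance (i n : ℕ) : AddCommGroup (Uni K i n) := inferInstanceAs (AddCommGroup (Fin n → K))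

instance (i n : ℕ) : Module K (Uni K i n) := inferInstanceAs (Module K (Fin n → K))

variable {K} {i n : ℕ}

/-- The `k`-th coordinate, with the convention that coordinates outside the range vanish. -/
def coeff (v : Uni K i n) (k : ℕ) : K := if h : k < n then v ⟨k, h⟩ else 0

/-- The vector with prescribed coordinates. -/
def mk (i n : ℕ) (c : ℕ → K) : Uni K i n := fun k => c k

@[simp] lemma coeff_mk (c : ℕ → K) (k : ℕ) : (mk i n c).coeff k = if k < n then c k else 0 := by
  simp [coeff, mk]

lemma coeff_of_le (v : Uni K i n) {k : ℕ} (h : n ≤ k) : v.coeff k = 0 := by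
  simp [coeff, Nat.not_lt.2 h]

@[ext] lemma ext {v w : Uni K i n} (h : ∀ k, k < n → v.coeff k = w.coeff k) : v = w := by
  funext k
  simpa [coeff] using h k k.2

@[simp] lemma coeff_add (v w : Uni K i n) (k : ℕ) : (v + w).coeff k = v.coeff k + w.coeff k := by
  unfold coeff
  split_ifs
  · rfl
  · simp

@[simp] lemma coeff_zero (k : ℕ) : (0 : Uni K i n).coeff k = 0 := by
  unfold coeff
  split_ifs <;> rfl

@[simp] lemma coeff_smul (c : K) (v : Uni K i n) (k : ℕ) : (c • v).coeff k = c * v.coeff k := by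
  unfold coeff
  split_ifs
  · rfl
  · simp

variable (K i n) in
/-- The operator by which the path of length `l` starting at `s mod 4` acts. -/
def shift (s l : ℕ) : Module.End K (Uni K i n) where
  toFun v := mk i n fun k => if l ≤ k ∧ (s + l) % 4 = (i + k) % 4 then v.coeff (k - l) else 0
  map_add' v w := by ext k hk; simp only [coeff_mk, coeff_add]; split_ifs <;> simp
  map_smul' c v := by ext k hk; simp only [coeff_mk, coeff_smul]; split_ifs <;> simp

lemma coeff_shift (s l : ℕ) (v : Uni K i n) (k : ℕ) :
    (shift K i n s l v).coeff k =
      if k < n ∧ l ≤ k ∧ (s + l) % 4 = (i + k) % 4 then v.coeff (k - l) else 0 := by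
  simp only [shift, LinearMap.coe_mk, AddHom.coe_mk, coeff_mk, ite_and]

lemma shift_congr {s s' : ℕ} (h : s % 4 = s' % 4) (l : ℕ) :
    shift K i n s l = shift K i n s' l := by
  ext v k hk
  rw [coeff_shift, coeff_shift]
  exact if_congr (by omega) rfl rfl

lemma shift_mul_shift (s' m s l : ℕ) :
    shift K i n s' m * shift K i n s l =
      if s' % 4 = (s + l) % 4 then shift K i n s (l + m) else 0 := by
  ext v k hk
  rw [Module.End.mul_apply, coeff_shift, coeff_shift, ← ite_and]
  split_ifs with h1 h2 h2
  · rw [coeff_shift, if_pos (by omega), show k - m - l = k - (l + m) by omega]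
  · omega
  · rw [coeff_shift, if_neg (by omega)]
  · simp

/-- The uniserial space is annihilated by the relations of `Λ`. -/
class Compatible (i n : ℕ) : Prop where
  out : ∀ k < n, 6 ≤ k → (i + k) % 2 = 1

lemma shift_eq_zero [h : Compatible i n] {s : ℕ} (hs : s % 2 = 0) : shift K i n s 6 = 0 := by
  ext v k hk
  have := h.out k hk
  rw [coeff_shift, if_neg (by omega)]
  simp

variable (K i n) in
/-- The images of the generators under the representation on `Uni K i n`. -/
noncomputable def genAction : PAGen (Fin 4) QC → (Module.End K (Uni K i n))ᵐᵒᵖ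
  | .vert j => MulOpposite.op (shift K i n j 0)
  | .arr e => MulOpposite.op (shift K i n (sC e) 1)

lemma genAction_rel [Compatible i n] ⦃x y : FreeAlgebra K (PAGen (Fin 4) QC)⦄
    (h : PARel K (Fin 4) QC sC tC ρC x y) :
    FreeAlgebra.lift K (genAction K i n) x = FreeAlgebra.lift K (genAction K i n) y := by
  cases h with
  | vert j j' =>
    rw [map_mul, apply_ite (FreeAlgebra.lift K (genAction K i n)), map_zero]
    simp only [FreeAlgebra.lift_ι_apply, genAction, ← MulOpposite.op_mul, shift_mul_shift]
    have := j.2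
    have := j'.2
    by_cases hj : j = j'
    · subst hj; simp
    · rw [if_neg (by rw [Fin.ext_iff] at hj; omega), if_neg hj, MulOpposite.op_zero]
  | one =>
    simp only [Fin.sum_univ_four, map_add, map_one, FreeAlgebra.lift_ι_apply, genAction,
      ← MulOpposite.op_add]
    rw [← MulOpposite.op_one]
    congr 1
    ext v k hk
    simp only [LinearMap.add_apply, coeff_add, coeff_shift, Module.End.one_apply, Nat.sub_zero]
    have : (i + k) % 4 < 4 := Nat.mod_lt _ (by norm_num)
    interval_cases h : (i + k) % 4 <;> simp [hk]
  | src e j =>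
    rw [map_mul, apply_ite (FreeAlgebra.lift K (genAction K i n)), map_zero]
    simp only [FreeAlgebra.lift_ι_apply, genAction, ← MulOpposite.op_mul, shift_mul_shift]
    have := j.2
    have := (sC e).2
    by_cases hj : j = sC e
    · subst hj; simp
    · rw [if_neg (by rw [Fin.ext_iff] at hj; omega), if_neg hj, MulOpposite.op_zero]
  | tgt e j =>
    rw [map_mul, apply_ite (FreeAlgebra.lift K (genAction K i n)), map_zero]
    simp only [FreeAlgebra.lift_ι_apply, genAction, ← MulOpposite.op_mul, shift_mul_shift]
    have := j.2
    have := tC_val e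
    by_cases hj : j = tC e
    · subst hj; rw [if_pos (by omega), if_pos rfl]
    · rw [if_neg (by rw [Fin.ext_iff] at hj; omega), if_neg hj, MulOpposite.op_zero]
  | rel p hp =>
    rcases hp with rfl | rfl <;>
    · simp only [List.map_cons, List.map_nil, List.prod_cons, List.prod_nil, map_mul,
        map_zero, mul_one, FreeAlgebra.lift_ι_apply, genAction, ← MulOpposite.op_mul,
        shift_mul_shift]
      simp [sC, shift_mul_shift, shift_eq_zero]

variable (K i n) in
/-- The representation of `Λ` on `Uni K i n`. -/
noncomputable def rep [Compatible i n] : ΛC K →ₐ[K] (Module.End K (Uni K i n))ᵐᵒᵖ :=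
  RingQuot.liftAlgHom K ⟨FreeAlgebra.lift K (genAction K i n), genAction_rel⟩

noncomputable instance [Compatible i n] : Module (ΛC K)ᵐᵒᵖ (Uni K i n) :=
  Module.compHom (Uni K i n) (AlgHom.opComm (rep K i n)).toRingHom

lemma op_smul_def [Compatible i n] (x : ΛC K) (v : Uni K i n) :
    MulOpposite.op x • v = (rep K i n x).unop v := rfl

lemma rep_vertex [Compatible i n] (j : ℕ) :
    rep K i n (vertex K j) = MulOpposite.op (shift K i n j 0) := by
  rw [vertex, eC, vtxEl, rep, RingQuot.liftAlgHom_mkAlgHom_apply, FreeAlgebra.lift_ι_apply]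
  exact congrArg MulOpposite.op (shift_congr (Nat.mod_mod _ _) 0)

lemma rep_arrow [Compatible i n] (j : ℕ) :
    rep K i n (arrow K j) = MulOpposite.op (shift K i n j 1) := by
  rw [arrow, arrEl, rep, RingQuot.liftAlgHom_mkAlgHom_apply, FreeAlgebra.lift_ι_apply, genAction,
    sC_arrowFrom]
  exact congrArg MulOpposite.op (shift_congr (Nat.mod_mod _ _) 1)

lemma rep_path [Compatible i n] (s l : ℕ) :
    rep K i n (path K s l) = MulOpposite.op (shift K i n s l) := by
  induction l with
  | zero => exact rep_vertex s
  | succ l ih =>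
    rw [path, map_mul, ih, rep_arrow, ← MulOpposite.op_mul, shift_mul_shift, if_pos rfl]

lemma path_smul [Compatible i n] (s l : ℕ) (v : Uni K i n) :
    MulOpposite.op (path K s l) • v = shift K i n s l v := by
  rw [op_smul_def, rep_path, MulOpposite.unop_op]

instance [Compatible i n] : IsScalarTower K (ΛC K)ᵐᵒᵖ (Uni K i n) where
  smul_assoc c r v := by
    induction r using MulOpposite.rec' with
    | h x =>
      rw [← MulOpposite.op_smul, op_smul_def, op_smul_def, map_smul]
      rfl

lemma coeff_path_smul [Compatible i n] (s l : ℕ) (v : Uni K i n) (k : ℕ) :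
    (MulOpposite.op (path K s l) • v).coeff k =
      if k < n ∧ l ≤ k ∧ (s + l) % 4 = (i + k) % 4 then v.coeff (k - l) else 0 := by
  rw [path_smul, coeff_shift]

variable (K) in
/-- The homomorphism of right `Λ`-modules sending the `k`-th basis vector to the `k + d`-th. -/
noncomputable def trans (i n i' n' d : ℕ) [Compatible i n] [Compatible i' n']
    (hi : i % 4 = (i' + d) % 4) (hn : n' ≤ n + d) :
    Uni K i n →ₗ[(ΛC K)ᵐᵒᵖ] Uni K i' n' :=
  let T : Uni K i n →ₗ[K] Uni K i' n' :=
    { toFun := fun v => mk i' n' fun k => if d ≤ k then v.coeff (k - d) else 0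
      map_add' := fun v w => by ext k hk; simp only [coeff_mk, coeff_add]; split_ifs <;> simp
      map_smul' := fun c v => by ext k hk; simp only [coeff_mk, coeff_smul]; split_ifs <;> simp }
  { T with
    map_smul' := fun r v => by
      induction r using MulOpposite.rec' with
      | h x =>
      change T (MulOpposite.op x • v) = MulOpposite.op x • T v
      induction x using path_induction with
      | hpath s l =>
        ext k hk
        simp only [T, LinearMap.coe_mk, AddHom.coe_mk, coeff_mk, coeff_path_smul, ← ite_and]
        split_ifs <;> first | omega | rfl | (congr 1; omega)
      | hzero => simp only [MulOpposite.op_zero, zero_smul, map_zero]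
      | hadd x y hx hy => simp only [MulOpposite.op_add, add_smul, map_add, hx, hy]
      | hsmul c x hx => simp only [MulOpposite.op_smul, smul_assoc, map_smul, hx] }

lemma coeff_trans {i' n' d : ℕ} [Compatible i n] [Compatible i' n']
    (hi : i % 4 = (i' + d) % 4) (hn : n' ≤ n + d) (v : Uni K i n) (k : ℕ) :
    (trans K i n i' n' d hi hn v).coeff k = if k < n' ∧ d ≤ k then v.coeff (k - d) else 0 := by
  simp [trans, ite_and]

lemma eq_zero_of_coeff_smul_eq_zero [Compatible i (n + 1)] {v : Uni K i (n + 1)}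
    (h : ∀ x : ΛC K, (MulOpposite.op x • v).coeff n = 0) : v = 0 := by
  ext k hk
  have := h (path K (i + k) (n - k))
  rwa [coeff_path_smul, if_pos (by omega), show n - (n - k) = k by omega, ← coeff_zero k] at this

/-- The uniserial module is injective as soon as every longer path ending at the vertex of its
socle vanishes in `Λ`. -/
theorem injective [Compatible i (n + 1)]
    (h : ∀ s l, n < l → (s + l) % 4 = (i + n) % 4 → path K s l = 0) :
    Module.Injective (ΛC K)ᵐᵒᵖ (Uni K i (n + 1)) := by
  apply Module.Baer.injective
  intro I g
  let f : I.restrictScalars K →ₗ[K] K :=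
    { toFun := fun x => (g ⟨x, x.2⟩).coeff n
      map_add' := fun x y => by
        rw [← coeff_add, ← map_add]; rfl
      map_smul' := fun c x => by
        have : (⟨((c • x : I.restrictScalars K) : (ΛC K)ᵐᵒᵖ), (c • x).2⟩ : I) =
            algebraMap K (ΛC K)ᵐᵒᵖ c • ⟨x, x.2⟩ := Subtype.ext (Algebra.smul_def c _)
        rw [this, map_smul, algebraMap_smul, coeff_smul]
        rfl }
  obtain ⟨ψ, hψ⟩ := f.exists_extend
  have hψ' : ∀ x (hx : x ∈ I), ψ x = (g ⟨x, hx⟩).coeff n := fun x hx =>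
    LinearMap.congr_fun hψ ⟨x, hx⟩
  let u : Uni K i (n + 1) := mk i (n + 1) fun k => ψ (MulOpposite.op (path K (i + k) (n - k)))
  have key : ∀ x : ΛC K,
      (MulOpposite.op x • u).coeff n = ψ (MulOpposite.op (x * vertex K (i + n))) := by
    intro x
    induction x using path_induction with
    | hpath s l =>
      rw [coeff_path_smul, path_mul_vertex]
      by_cases hl : (s + l) % 4 = (i + n) % 4
      · rw [if_pos hl]
        by_cases hln : l ≤ n
        · rw [if_pos ⟨by omega, hln, hl⟩, coeff_mk, if_pos (by omega),
            show n - (n - l) = l by omega, path_congr K (s' := s) (by omega)]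
        · rw [if_neg (by omega), h s l (by omega) hl, MulOpposite.op_zero, map_zero]
      · rw [if_neg (by omega), if_neg hl, MulOpposite.op_zero, map_zero]
    | hzero => simp
    | hadd x y hx hy =>
      rw [MulOpposite.op_add, add_smul, coeff_add, hx, hy, add_mul, MulOpposite.op_add, map_add]
    | hsmul c x hx =>
      rw [MulOpposite.op_smul, smul_assoc, coeff_smul, hx, smul_mul_assoc, MulOpposite.op_smul,
        map_smul, smul_eq_mul]
  refine ⟨LinearMap.toSpanSingleton _ _ u, fun r hr => ?_⟩
  rw [LinearMap.toSpanSingleton_apply, ← sub_eq_zero]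
  refine eq_zero_of_coeff_smul_eq_zero fun x => ?_
  have hmem : MulOpposite.op (r.unop * x * vertex K (i + n)) ∈ I := by
    rw [mul_assoc, MulOpposite.op_mul, MulOpposite.op_unop]
    exact I.mul_mem_left _ hr
  have hg : g ⟨_, hmem⟩ =
      MulOpposite.op (path K (i + n) 0) • MulOpposite.op x • g ⟨r, hr⟩ := by
    rw [← map_smul, ← map_smul]
    congr 1
  rw [smul_sub, sub_eq_add_neg, coeff_add, ← neg_one_smul K, coeff_smul, neg_one_mul,
    ← sub_eq_add_neg, sub_eq_zero, ← mul_smul,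
    show MulOpposite.op x * r = MulOpposite.op (r.unop * x) from rfl, key,
    hψ' _ hmem, hg, coeff_path_smul, if_pos (by omega), Nat.sub_zero]

lemma Compatible.pred (h : Compatible i (n + 1)) : Compatible i n :=
  ⟨fun k hk => h.out k (by omega)⟩

/-- Such a uniserial module is the injective envelope of the simple module at the vertex of its
last composition factor. -/
theorem isInjEnvAt [hc : Compatible i (n + 1)]
    (h : ∀ s l, n < l → (s + l) % 4 = (i + n) % 4 → path K s l = 0) :
    IsInjEnvAt (ΛC K) (vertex K (i + n)) (Uni K i (n + 1)) := by
  have := hc.pred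
  let N : Submodule (ΛC K)ᵐᵒᵖ (Uni K i (n + 1)) :=
    LinearMap.ker (trans K i (n + 1) i n 0 rfl (by omega))
  have hN : ∀ v, v ∈ N ↔ ∀ k < n, v.coeff k = 0 := fun v => by
    rw [LinearMap.mem_ker]
    refine ⟨fun hv k hk => ?_, fun hv => ?_⟩
    · have := congrArg (coeff · k) hv
      simpa [coeff_trans, hk] using this
    · ext k hk
      simp [coeff_trans, hv k hk]
  have hlast : ∀ v ∈ N, v ≠ 0 → v.coeff n ≠ 0 := fun v hv hv0 hn => hv0 <| by
    ext k hk
    rcases Nat.lt_succ_iff_lt_or_eq.1 hk with hk | rfl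
    · rw [(hN v).1 hv k hk, coeff_zero]
    · rw [hn, coeff_zero]
  let w : Uni K i (n + 1) := mk i (n + 1) fun k => if k = n then 1 else 0
  have hw : w ∈ N := (hN w).2 fun k hk => by
    rw [coeff_mk, if_pos (by omega), if_neg (by omega)]
  have hwn : w.coeff n = 1 := by simp [w]
  have hw0 : w ≠ 0 := fun h0 => by simp [h0] at hwn
  refine ⟨injective h, N, fun N' hN' hbot => ?_, ?_, ⟨w, hw⟩, ?_, ?_⟩
  · obtain ⟨v, hv, hv0⟩ := N'.ne_bot_iff.1 hN'
    have hex : ∃ k, v.coeff k ≠ 0 := by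
      by_contra! hall
      exact hv0 (ext fun k _ => by rw [hall k, coeff_zero])
    classical
    have hk := Nat.find_spec hex
    have hmin : ∀ m < Nat.find hex, v.coeff m = 0 := fun m hm => not_not.1 (Nat.find_min hex hm)
    set k := Nat.find hex
    have hkn : k < n + 1 := by
      by_contra! hle
      exact hk (coeff_of_le v hle)
    have hmem : MulOpposite.op (path K (i + k) (n - k)) • v ∈ N ⊓ N' := by
      refine ⟨(hN _).2 fun m hm => ?_, N'.smul_mem _ hv⟩
      rw [coeff_path_smul]
      split_ifs with hc
      · exact hmin _ (by omega)
      · rfl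
    rw [hbot, Submodule.mem_bot] at hmem
    have := congrArg (coeff · n) hmem
    simp only [coeff_path_smul, coeff_zero] at this
    rw [if_pos (by omega), show n - (n - k) = k by omega] at this
    exact hk this
  · rw [isSimpleModule_iff_toSpanSingleton_surjective]
    refine ⟨⟨⟨w, hw⟩, 0, fun h0 => hw0 (congrArg Subtype.val h0)⟩, ?_⟩
    rintro ⟨v, hv⟩ hv0 ⟨v', hv'⟩
    have hvn := hlast v hv fun h0 => hv0 (Subtype.ext h0)
    refine ⟨algebraMap K _ (v'.coeff n / v.coeff n), Subtype.ext ?_⟩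
    change algebraMap K (ΛC K)ᵐᵒᵖ (v'.coeff n / v.coeff n) • v = v'
    ext k hk
    rw [algebraMap_smul, coeff_smul]
    rcases Nat.lt_succ_iff_lt_or_eq.1 hk with hk | rfl
    · rw [(hN v).1 hv k hk, (hN v').1 hv' k hk, mul_zero]
    · exact div_mul_cancel₀ _ hvn
  · exact fun h0 => hw0 (congrArg Subtype.val h0)
  · refine Subtype.ext ?_
    change MulOpposite.op (path K (i + n) 0) • w = w
    ext k hk
    rw [coeff_path_smul]
    simp only [w, coeff_mk]
    split_ifs <;> first | rfl | omega

section Trans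

variable {i' n' d i'' n'' d' : ℕ} [Compatible i n] [Compatible i' n'] [Compatible i'' n'']
  (hi : i % 4 = (i' + d) % 4) (hn : n' ≤ n + d) (hi' : i' % 4 = (i'' + d') % 4) (hn' : n'' ≤ n' + d')

lemma trans_injective (h : n + d ≤ n') : Function.Injective (trans K i n i' n' d hi hn) := by
  rw [← LinearMap.ker_eq_bot, LinearMap.ker_eq_bot']
  intro v hv
  ext k hk
  have := congrArg (coeff · (k + d)) hv
  simpa [coeff_trans, show k + d < n' by omega] using this

lemma trans_surjective (h : d = 0) : Function.Surjective (trans K i n i' n' d hi hn) := by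
  subst h
  intro w
  refine ⟨mk i n fun k => w.coeff k, ?_⟩
  ext k hk
  simp [coeff_trans, hk, show k < n by omega]

lemma trans_exact (h : n'' = d + d') :
    Function.Exact (trans K i n i' n' d hi hn) (trans K i' n' i'' n'' d' hi' hn') := by
  intro v
  constructor
  · intro hv
    refine ⟨mk i n fun k => v.coeff (k + d), ?_⟩
    ext k hk
    rw [coeff_trans, coeff_mk]
    by_cases hdk : d ≤ k
    · rw [if_pos ⟨hk, hdk⟩, if_pos (by omega), Nat.sub_add_cancel hdk]
    · have := congrArg (coeff · (k + d')) hv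
      rw [if_neg (by omega)]
      simpa [coeff_trans, show k + d' < n'' by omega, eq_comm] using this
  · rintro ⟨w, rfl⟩
    ext k hk
    rw [coeff_trans, coeff_trans, ← ite_and, if_neg (by omega), coeff_zero]

end Trans

/-- The basis vector at the top of a uniserial module. -/
def top (K : Type) [Field K] (i n : ℕ) : Uni K i n := mk i n fun k => if k = 0 then 1 else 0

/-- A uniserial module that embeds as a proper submodule of another one is not injective. -/
theorem not_injective {i' n' d : ℕ} [Compatible i n] [Compatible i' n']
    (hi : i % 4 = (i' + d) % 4) (hn : n' ≤ n + d) (h : n + d ≤ n') (hn0 : 0 < n) (hd : 0 < d) :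
    ¬ Module.Injective (ΛC K)ᵐᵒᵖ (Uni K i n) := by
  intro hinj
  obtain ⟨r, hr⟩ := hinj.out (trans K i n i' n' d hi hn) (trans_injective hi hn h) LinearMap.id
  have htop : trans K i n i' n' d hi hn (top K i n) =
      MulOpposite.op (path K i' d) • top K i' n' := by
    ext k hk
    rw [coeff_trans, coeff_path_smul, top, top, coeff_mk, coeff_mk]
    simp only [← ite_and]
    split_ifs <;> first | rfl | omega
  have := congrArg (coeff · 0) (hr (top K i n))
  simp only [htop, map_smul, coeff_path_smul, LinearMap.id_apply] at this
  rw [if_neg (by omega), top, coeff_mk, if_pos hn0, if_pos rfl] at this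
  exact zero_ne_one this

/-! ## The indecomposable projective modules -/

variable (K i n) in
/-- The homomorphism from `Λ` to a uniserial module sending `1` to the top basis vector. -/
noncomputable def ofAlgebra [Compatible i n] : ΛC K →ₗ[(ΛC K)ᵐᵒᵖ] Uni K i n where
  toFun x := MulOpposite.op x • top K i n
  map_add' x y := by rw [MulOpposite.op_add, add_smul]
  map_smul' r x := mul_smul r (MulOpposite.op x) (top K i n)

lemma ofAlgebra_path [Compatible i n] (s l : ℕ) :
    ofAlgebra K i n (path K s l) =
      if s % 4 = i % 4 then mk i n fun k => if k = l then 1 else 0 else 0 := by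
  ext k hk
  change (MulOpposite.op (path K s l) • top K i n).coeff k = _
  rw [coeff_path_smul, top, apply_ite (coeff · k), coeff_zero, coeff_mk, coeff_mk]
  simp only [← ite_and]
  split_ifs <;> first | rfl | omega

lemma ofAlgebra_smul [Compatible i n] (c : K) (x : ΛC K) :
    ofAlgebra K i n (c • x) = c • ofAlgebra K i n x :=
  smul_assoc c (MulOpposite.op x) (top K i n)

lemma ofAlgebra_vertex_mul [Compatible i n] (j : ℕ) (x : ΛC K) :
    ofAlgebra K i n (vertex K j * x) = if j % 4 = i % 4 then ofAlgebra K i n x else 0 := by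
  induction x using path_induction with
  | hpath s l =>
    rw [vertex_mul_path, apply_ite (ofAlgebra K i n), map_zero, ofAlgebra_path]
    split_ifs <;> first | rfl | omega
  | hzero => simp
  | hadd x y hx hy => rw [mul_add, map_add, hx, hy, map_add]; split_ifs <;> simp
  | hsmul c x hx => rw [mul_smul_comm, ofAlgebra_smul, hx, ofAlgebra_smul]; split_ifs <;> simp

lemma ofAlgebra_surjective [Compatible i n] : Function.Surjective (ofAlgebra K i n) := by
  intro v
  let c : ℕ → Uni K i n →ₗ[K] K := fun k =>
    { toFun := fun v => v.coeff k
      map_add' := fun v w => coeff_add v w k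
      map_smul' := fun a v => coeff_smul a v k }
  refine ⟨∑ l ∈ Finset.range n, v.coeff l • path K i l, ?_⟩
  ext k hk
  rw [map_sum]
  change c k _ = _
  rw [map_sum]
  simp [ofAlgebra_path, c, hk]

lemma vertex_mul_eq_zero [Compatible i n] (h : ∀ l, n ≤ l → path K i l = 0) {x : ΛC K}
    (hx : ofAlgebra K i n x = 0) : vertex K i * x = 0 := by
  have key : ∀ x : ΛC K,
      vertex K i * x = ∑ l ∈ Finset.range n, (ofAlgebra K i n x).coeff l • path K i l := by
    intro x
    induction x using path_induction with
    | hpath s l =>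
      rw [vertex_mul_path, ofAlgebra_path]
      by_cases hs : i % 4 = s % 4
      · rw [if_pos hs, if_pos hs.symm, path_congr K hs.symm]
        by_cases hl : l < n
        · rw [Finset.sum_eq_single_of_mem l (Finset.mem_range.2 hl) fun k _ hk => by simp [hk]]
          simp [hl]
        · rw [h l (by omega), eq_comm]
          refine Finset.sum_eq_zero fun k hk => ?_
          have := Finset.mem_range.1 hk
          rw [coeff_mk, if_pos this, if_neg (by omega), zero_smul]
      · rw [if_neg hs, if_neg (Ne.symm hs)]
        simp
    | hzero => simp
    | hadd x y hx hy => simp only [mul_add, hx, hy, map_add, coeff_add, add_smul,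
        Finset.sum_add_distrib]
    | hsmul c x hx => simp only [mul_smul_comm, hx, ofAlgebra_smul, coeff_smul, mul_smul,
        Finset.smul_sum]
  simp [key, hx]

lemma mem_eRC_iff (x : ΛC K) : x ∈ eRC K (Fin.ofNat 4 i) ↔ vertex K i * x = x := by
  refine (Submodule.mem_span_singleton).trans ⟨?_, fun h => ⟨MulOpposite.op x, h⟩⟩
  rintro ⟨r, rfl⟩
  change vertex K i * (vertex K i * r.unop) = vertex K i * r.unop
  rw [← mul_assoc, vertex_mul_vertex, if_pos rfl]

/-- The indecomposable projective module at a vertex is uniserial. -/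
noncomputable def eRCEquiv [Compatible i n] (h : ∀ l, n ≤ l → path K i l = 0) :
    eRC K (Fin.ofNat 4 i) ≃ₗ[(ΛC K)ᵐᵒᵖ] Uni K i n :=
  LinearEquiv.ofBijective ((ofAlgebra K i n).domRestrict (eRC K (Fin.ofNat 4 i))) <| by
    constructor
    · refine (injective_iff_map_eq_zero _).2 ?_
      rintro ⟨x, hx⟩ hx0
      exact Subtype.ext (((mem_eRC_iff x).1 hx).symm.trans (vertex_mul_eq_zero h hx0))
    · intro v
      obtain ⟨x, rfl⟩ := ofAlgebra_surjective v
      refine ⟨⟨vertex K i * x, (mem_eRC_iff _).2 ?_⟩, ?_⟩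
      · rw [← mul_assoc, vertex_mul_vertex, if_pos rfl]
      · exact (ofAlgebra_vertex_mul i x).trans (if_pos rfl)

instance : Compatible 0 6 := ⟨by omega⟩
instance : Compatible 1 7 := ⟨by omega⟩
instance : Compatible 2 6 := ⟨by omega⟩
instance : Compatible 3 7 := ⟨by omega⟩
instance : Compatible 1 6 := ⟨by omega⟩
instance : Compatible 3 6 := ⟨by omega⟩
instance : Compatible 1 1 := ⟨by omega⟩
instance : Compatible 3 1 := ⟨by omega⟩
instance : Compatible 0 2 := ⟨by omega⟩

variable (K) in
/-- The decomposition of `Λ` into indecomposable projective right modules. -/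
noncomputable def algebraEquiv : ΛC K ≃ₗ[(ΛC K)ᵐᵒᵖ]
    (Uni K 0 6 × Uni K 1 7) × (Uni K 2 6 × Uni K 3 7) :=
  LinearEquiv.ofBijective
    (((ofAlgebra K 0 6).prod (ofAlgebra K 1 7)).prod ((ofAlgebra K 2 6).prod (ofAlgebra K 3 7))) <| by
    constructor
    · rw [← LinearMap.ker_eq_bot, LinearMap.ker_eq_bot']
      intro x hx
      simp only [LinearMap.prod_apply, Function.prod_apply, Prod.mk_eq_zero] at hx
      obtain ⟨⟨h0, h1⟩, h2, h3⟩ := hx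
      rw [← one_mul x, ← sum_vertex, add_mul, add_mul, add_mul,
        vertex_mul_eq_zero (fun l hl => path_even_eq_zero K (by norm_num) hl) h0,
        vertex_mul_eq_zero (fun l hl => path_eq_zero K hl) h1,
        vertex_mul_eq_zero (fun l hl => path_even_eq_zero K (by norm_num) hl) h2,
        vertex_mul_eq_zero (fun l hl => path_eq_zero K hl) h3]
      simp
    · rintro ⟨⟨v0, v1⟩, v2, v3⟩
      obtain ⟨x0, rfl⟩ := ofAlgebra_surjective v0
      obtain ⟨x1, rfl⟩ := ofAlgebra_surjective v1
      obtain ⟨x2, rfl⟩ := ofAlgebra_surjective v2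
      obtain ⟨x3, rfl⟩ := ofAlgebra_surjective v3
      refine ⟨vertex K 0 * x0 + vertex K 1 * x1 + vertex K 2 * x2 + vertex K 3 * x3, ?_⟩
      simp [ofAlgebra_vertex_mul]

lemma isInjEnvAt_of_length_seven [Compatible i 7] :
    IsInjEnvAt (ΛC K) (vertex K (i + 6)) (Uni K i 7) :=
  isInjEnvAt fun _ _ hl _ => path_eq_zero K hl

lemma isInjEnvAt_of_length_six [Compatible i 6] (hi : i % 2 = 1) :
    IsInjEnvAt (ΛC K) (vertex K (i + 5)) (Uni K i 6) :=
  isInjEnvAt fun s l hl hs => by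
    rcases Nat.lt_or_ge 6 l with h | h
    · exact path_eq_zero K h
    · exact path_even_eq_zero K (by omega) (by omega)

variable (K)

/-- The embedding of the projective module at vertex `0` in an injective module. -/
noncomputable abbrev incl₀ : Uni K 0 6 →ₗ[(ΛC K)ᵐᵒᵖ] Uni K 3 7 :=
  trans K 0 6 3 7 1 rfl le_rfl

/-- The embedding of the projective module at vertex `2` in an injective module. -/
noncomputable abbrev incl₂ : Uni K 2 6 →ₗ[(ΛC K)ᵐᵒᵖ] Uni K 1 7 :=
  trans K 2 6 1 7 1 rfl le_rfl

/-- The map from the projective module at vertex `3` onto the socle of the one at vertex `1`. -/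
noncomputable abbrev toSocle₃ : Uni K 3 7 →ₗ[(ΛC K)ᵐᵒᵖ] Uni K 1 7 :=
  trans K 3 7 1 7 6 rfl (by norm_num)

/-- The map from the projective module at vertex `1` onto the socle of the one at vertex `3`. -/
noncomputable abbrev toSocle₁ : Uni K 1 7 →ₗ[(ΛC K)ᵐᵒᵖ] Uni K 3 7 :=
  trans K 1 7 3 7 6 rfl (by norm_num)

/-- The quotient of the projective module at vertex `1` by its socle. -/
noncomputable abbrev modSocle₁ : Uni K 1 7 →ₗ[(ΛC K)ᵐᵒᵖ] Uni K 1 6 :=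
  trans K 1 7 1 6 0 rfl (by norm_num)

/-- The quotient of the projective module at vertex `3` by its socle. -/
noncomputable abbrev modSocle₃ : Uni K 3 7 →ₗ[(ΛC K)ᵐᵒᵖ] Uni K 3 6 :=
  trans K 3 7 3 6 0 rfl (by norm_num)

lemma incl₀_injective : Function.Injective (incl₀ K) := trans_injective _ _ (by norm_num)

lemma incl₂_injective : Function.Injective (incl₂ K) := trans_injective _ _ (by norm_num)

lemma exact_incl₀_toSocle₃ : Function.Exact (incl₀ K) (toSocle₃ K) := trans_exact _ _ _ _ rfl

lemma exact_incl₂_toSocle₁ : Function.Exact (incl₂ K) (toSocle₁ K) := trans_exact _ _ _ _ rfl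

lemma exact_toSocle₃_modSocle₁ : Function.Exact (toSocle₃ K) (modSocle₁ K) :=
  trans_exact _ _ _ _ rfl

lemma exact_toSocle₁_modSocle₃ : Function.Exact (toSocle₁ K) (modSocle₃ K) :=
  trans_exact _ _ _ _ rfl

lemma modSocle₁_surjective : Function.Surjective (modSocle₁ K) := trans_surjective _ _ rfl

lemma modSocle₃_surjective : Function.Surjective (modSocle₃ K) := trans_surjective _ _ rfl

/-- The embedding of `Λ` into an injective module. -/
noncomputable def embedding : ΛC K →ₗ[(ΛC K)ᵐᵒᵖ]
    (Uni K 3 7 × Uni K 1 7) × (Uni K 1 7 × Uni K 3 7) :=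
  (((incl₀ K).prodMap LinearMap.id).prodMap ((incl₂ K).prodMap LinearMap.id)) ∘ₗ
    (algebraEquiv K).toLinearMap

lemma embedding_injective : Function.Injective (embedding K) := by
  rw [embedding, LinearMap.coe_comp]
  refine Function.Injective.comp ?_ (algebraEquiv K).injective
  exact ((incl₀_injective K).prodMap Function.injective_id).prodMap
    ((incl₂_injective K).prodMap Function.injective_id)

variable {K} in
lemma embedding_exact {A B : Type} [AddCommGroup A] [Module (ΛC K)ᵐᵒᵖ A] [AddCommGroup B]
    [Module (ΛC K)ᵐᵒᵖ B] {p : Uni K 3 7 →ₗ[(ΛC K)ᵐᵒᵖ] A} {q : Uni K 1 7 →ₗ[(ΛC K)ᵐᵒᵖ] B}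
    (hp : Function.Exact (incl₀ K) p)
    (hq : Function.Exact (incl₂ K) q) :
    Function.Exact (embedding K)
      ((p ∘ₗ LinearMap.fst _ (Uni K 3 7) (Uni K 1 7)).prodMap
        (q ∘ₗ LinearMap.fst _ (Uni K 1 7) (Uni K 3 7))) := by
  rintro ⟨⟨a, b⟩, c, d⟩
  rw [LinearMap.prodMap_apply, Prod.mk_eq_zero]
  refine (and_congr (hp a) (hq c)).trans ⟨?_, ?_⟩
  · rintro ⟨⟨a, rfl⟩, c, rfl⟩
    exact ⟨(algebraEquiv K).symm ((a, b), (c, d)), by simp [embedding]⟩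
  · rintro ⟨x, hx⟩
    exact ⟨⟨_, congrArg (fun y => y.1.1) hx⟩, ⟨_, congrArg (fun y => y.2.1) hx⟩⟩

lemma injective_embedding : Module.Injective (ΛC K)ᵐᵒᵖ
    ((Uni K 3 7 × Uni K 1 7) × (Uni K 1 7 × Uni K 3 7)) :=
  (isInjEnvAt_of_length_seven.1.prod isInjEnvAt_of_length_seven.1).prod
    (isInjEnvAt_of_length_seven.1.prod isInjEnvAt_of_length_seven.1)

theorem injDimLE_two : InjDimLE (ΛC K)ᵐᵒᵖ 2 (ModuleCat.of (ΛC K)ᵐᵒᵖ (ΛC K)) :=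
  injDimLE_two_of_exact (embedding K)
    ((toSocle₃ K ∘ₗ LinearMap.fst _ _ _).prodMap (toSocle₁ K ∘ₗ LinearMap.fst _ _ _))
    ((modSocle₁ K).prodMap (modSocle₃ K))
    (embedding_injective K)
    (embedding_exact (exact_incl₀_toSocle₃ K) (exact_incl₂_toSocle₁ K))
    (by
      rintro ⟨a, b⟩
      rw [LinearMap.prodMap_apply, Prod.mk_eq_zero]
      refine (and_congr (exact_toSocle₃_modSocle₁ K a) (exact_toSocle₁_modSocle₃ K b)).trans
        ⟨?_, ?_⟩
      · rintro ⟨⟨a, rfl⟩, b, rfl⟩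
        exact ⟨((a, 0), (b, 0)), rfl⟩
      · rintro ⟨x, hx⟩
        exact ⟨⟨_, congrArg Prod.fst hx⟩, ⟨_, congrArg Prod.snd hx⟩⟩)
    ((modSocle₁_surjective K).prodMap (modSocle₃_surjective K))
    (injective_embedding K)
    (isInjEnvAt_of_length_seven.1.prod isInjEnvAt_of_length_seven.1)
    ((isInjEnvAt_of_length_six rfl).1.prod (isInjEnvAt_of_length_six rfl).1)

theorem not_injDimLE_one : ¬ InjDimLE (ΛC K)ᵐᵒᵖ 1 (ModuleCat.of (ΛC K)ᵐᵒᵖ (ΛC K)) := by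
  intro h
  let p := trans K 3 7 3 1 0 rfl (by norm_num)
  let q := trans K 1 7 1 1 0 rfl (by norm_num)
  have hp : Function.Exact (incl₀ K) p := trans_exact _ _ _ _ rfl
  have hq : Function.Exact (incl₂ K) q := trans_exact _ _ _ _ rfl
  have hp' : Function.Surjective p := trans_surjective _ _ rfl
  have hq' : Function.Surjective q := trans_surjective _ _ rfl
  have hinj := h.injective_of_exact (embedding K) _ (embedding_injective K)
    (embedding_exact hp hq)
    ((hp'.comp Prod.fst_surjective).prodMap (hq'.comp Prod.fst_surjective)) (injective_embedding K)
  have hS : Module.Injective (ΛC K)ᵐᵒᵖ (Uni K 1 1) :=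
    hinj.of_retract (LinearMap.inr _ _ _) (LinearMap.snd _ _ _) fun _ => rfl
  exact not_injective (i := 1) (i' := 0) (n' := 2) (d := 1) rfl le_rfl le_rfl one_pos one_pos hS

theorem not_injective_two : ¬ Module.Injective (ΛC K)ᵐᵒᵖ (Uni K 2 6) :=
  not_injective (i' := 1) (n' := 7) (d := 1) rfl le_rfl le_rfl (by norm_num) one_pos

end Uni

end CyclicQuiver

/-- **Example 3.2, injective dimension.**  For `Λ = KQ/I` as above: the indecomposable
projective right `Λ`-modules `e_2Λ` and `e_4Λ` are injective, `e_3Λ` is not injective (so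
`Λ` is not self-injective), and there are injective resolutions
`0 → e_1Λ → I(2) → I(4) → I(3) → 0` and `0 → e_3Λ → I(4) → I(2) → I(1) → 0`, where `I(j)`
is the indecomposable injective right `Λ`-module corresponding to the vertex `j`;
consequently the injective dimension of `Λ` as a right `Λ`-module is `2`. -/
theorem statement15 {K : Type} [Field K] [IsAlgClosed K] (hchar : ringChar K ≠ 2) :
    Module.Injective (ΛC K)ᵐᵒᵖ ↥(eRC K 1) ∧
    Module.Injective (ΛC K)ᵐᵒᵖ ↥(eRC K 3) ∧
    ¬ Module.Injective (ΛC K)ᵐᵒᵖ ↥(eRC K 2) ∧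
    ¬ Module.Injective (ΛC K)ᵐᵒᵖ (ΛC K) ∧
    (∃ (I2 I4 I3 : ModuleCat.{0} (ΛC K)ᵐᵒᵖ),
      IsInjEnvAt (ΛC K) (eC K 1) I2 ∧ IsInjEnvAt (ΛC K) (eC K 3) I4 ∧
      IsInjEnvAt (ΛC K) (eC K 2) I3 ∧
      ∃ (f : ↥(eRC K 0) →ₗ[(ΛC K)ᵐᵒᵖ] I2) (g : I2 →ₗ[(ΛC K)ᵐᵒᵖ] I4)
        (h : I4 →ₗ[(ΛC K)ᵐᵒᵖ] I3),
        Function.Injective f ∧ Function.Exact f g ∧ Function.Exact g h ∧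
        Function.Surjective h) ∧
    (∃ (I4 I2 I1 : ModuleCat.{0} (ΛC K)ᵐᵒᵖ),
      IsInjEnvAt (ΛC K) (eC K 3) I4 ∧ IsInjEnvAt (ΛC K) (eC K 1) I2 ∧
      IsInjEnvAt (ΛC K) (eC K 0) I1 ∧
      ∃ (f : ↥(eRC K 2) →ₗ[(ΛC K)ᵐᵒᵖ] I4) (g : I4 →ₗ[(ΛC K)ᵐᵒᵖ] I2)
        (h : I2 →ₗ[(ΛC K)ᵐᵒᵖ] I1),
        Function.Injective f ∧ Function.Exact f g ∧ Function.Exact g h ∧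
        Function.Surjective h) ∧
    InjDimLE (ΛC K)ᵐᵒᵖ 2 (ModuleCat.of (ΛC K)ᵐᵒᵖ (ΛC K)) ∧
    ¬ InjDimLE (ΛC K)ᵐᵒᵖ 1 (ModuleCat.of (ΛC K)ᵐᵒᵖ (ΛC K)) := by
  open CyclicQuiver CyclicQuiver.Uni in
  have h6 : ∀ i l : ℕ, i % 2 = 0 → 6 ≤ l → path K i l = 0 :=
    fun i l hi hl => path_even_eq_zero K hi hl
  have h7 : ∀ i l : ℕ, 7 ≤ l → path K i l = 0 := fun i l hl => path_eq_zero K hl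
  let e0 : eRC K 0 ≃ₗ[(ΛC K)ᵐᵒᵖ] Uni K 0 6 := eRCEquiv fun l => h6 0 l rfl
  let e1 : eRC K 1 ≃ₗ[(ΛC K)ᵐᵒᵖ] Uni K 1 7 := eRCEquiv (h7 1)
  let e2 : eRC K 2 ≃ₗ[(ΛC K)ᵐᵒᵖ] Uni K 2 6 := eRCEquiv fun l => h6 2 l rfl
  let e3 : eRC K 3 ≃ₗ[(ΛC K)ᵐᵒᵖ] Uni K 3 7 := eRCEquiv (h7 3)
  have I2 : IsInjEnvAt (ΛC K) (eC K 1) (Uni K 3 7) := isInjEnvAt_of_length_seven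
  have I4 : IsInjEnvAt (ΛC K) (eC K 3) (Uni K 1 7) := isInjEnvAt_of_length_seven
  have I3 : IsInjEnvAt (ΛC K) (eC K 2) (Uni K 1 6) := isInjEnvAt_of_length_six rfl
  have I1 : IsInjEnvAt (ΛC K) (eC K 0) (Uni K 3 6) := isInjEnvAt_of_length_six rfl
  refine ⟨I4.1.of_linearEquiv e1, I2.1.of_linearEquiv e3,
    fun h => not_injective_two K (h.of_linearEquiv e2.symm), fun h => ?_,
    ⟨ModuleCat.of _ (Uni K 3 7), ModuleCat.of _ (Uni K 1 7), ModuleCat.of _ (Uni K 1 6),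
      I2, I4, I3, incl₀ K ∘ₗ e0.toLinearMap, toSocle₃ K, modSocle₁ K,
      (incl₀_injective K).comp e0.injective,
      e0.surjective.comp_exact_iff_exact.2 (exact_incl₀_toSocle₃ K),
      exact_toSocle₃_modSocle₁ K, modSocle₁_surjective K⟩,
    ⟨ModuleCat.of _ (Uni K 1 7), ModuleCat.of _ (Uni K 3 7), ModuleCat.of _ (Uni K 3 6),
      I4, I2, I1, incl₂ K ∘ₗ e2.toLinearMap, toSocle₁ K, modSocle₃ K,
      (incl₂_injective K).comp e2.injective,
      e2.surjective.comp_exact_iff_exact.2 (exact_incl₂_toSocle₁ K),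
      exact_toSocle₁_modSocle₃ K, modSocle₃_surjective K⟩,
    injDimLE_two K, not_injDimLE_one K⟩
  let p := LinearMap.fst (ΛC K)ᵐᵒᵖ (Uni K 2 6) (Uni K 3 7) ∘ₗ
      LinearMap.snd (ΛC K)ᵐᵒᵖ (Uni K 0 6 × Uni K 1 7) (Uni K 2 6 × Uni K 3 7)
  let j := LinearMap.inr (ΛC K)ᵐᵒᵖ (Uni K 0 6 × Uni K 1 7) (Uni K 2 6 × Uni K 3 7) ∘ₗ
      LinearMap.inl (ΛC K)ᵐᵒᵖ (Uni K 2 6) (Uni K 3 7)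
  exact not_injective_two K ((h.of_linearEquiv (algebraEquiv K).symm).of_retract j p
      fun _ => rfl)
end

section
/- Let Λ = KQ/I where Q is the quiver with vertices 1, 2, 3, a loop α at vertex 1, arrows a: 1→2, b: 2→1, c: 2→1, β: 2→3, γ: 3→2, and I = ⟨α², βγ, γβ, ab, ac, ba, ca⟩. Then the indecomposable injective right Λ-module I(3) corresponding to vertex 3 has a minimal projective resolution ⋯ → U_3 → U_2 → U_1 → e_3Λ ⊕ e_3Λ → I(3) → 0 with U_i = (e_1Λ)^{⊕ 3·2^{m−1}} if i = 2m−1 and U_i = (e_2Λ)^{⊕ 3·2^{m−1}} if i = 2m; hence I(3) has infinite projective dimension, the left module Λe_3 has infinite injective dimension, and Λ is not Gorenstein. -/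
/-! ## The quiver `Q` of Example 3.3: vertices `1, 2, 3` (here `0, 1, 2` : `Fin 3`),
a loop `α` at vertex `1`, arrows `a : 1→2, b : 2→1, c : 2→1, β : 2→3, γ : 3→2`,
relations `I = ⟨α², βγ, γβ, ab, ac, ba, ca⟩`. -/

inductive QD : Type | α | a | b | c | β | γ

def sD : QD → Fin 3
  | .α => 0 | .a => 0 | .b => 1 | .c => 1 | .β => 1 | .γ => 2

def tD : QD → Fin 3
  | .α => 0 | .a => 1 | .b => 0 | .c => 0 | .β => 2 | .γ => 1

def ρD : Set (List QD) :=
  {[QD.α, QD.α], [QD.β, QD.γ], [QD.γ, QD.β], [QD.a, QD.b], [QD.a, QD.c],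
   [QD.b, QD.a], [QD.c, QD.a]}

/-- The monomial algebra `Λ = KQ/I` of Example 3.3. -/
abbrev ΛD (K : Type) [Field K] : Type := MonAlg K (Fin 3) QD sD tD ρD

/-- The trivial path `e_i` in `Λ`. -/
noncomputable def eD (K : Type) [Field K] (i : Fin 3) : ΛD K :=
  vtxEl K (Fin 3) QD sD tD ρD i

/-- The indecomposable projective right `Λ`-module `e_iΛ`, as a right ideal. -/
noncomputable def eRD (K : Type) [Field K] (i : Fin 3) : Submodule (ΛD K)ᵐᵒᵖ (ΛD K) :=
  Submodule.span (ΛD K)ᵐᵒᵖ {eD K i}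

/-- The indecomposable projective left `Λ`-module `Λe_i`, as a left ideal. -/
noncomputable def eLD (K : Type) [Field K] (i : Fin 3) : Submodule (ΛD K) (ΛD K) :=
  Submodule.span (ΛD K) {eD K i}

noncomputable section

/-! ### Multiplication rules in the algebra `Λ` -/

instance : DecidableEq QD := fun x y => by
  cases x <;> cases y <;> first
    | exact isTrue rfl
    | exact isFalse (by simp)

instance : Fintype QD where
  elems := {.α, .a, .b, .c, .β, .γ}
  complete x := by cases x <;> decide

theorem QD.sum_eq {M : Type} [AddCommMonoid M] (f : QD → M) :
    ∑ g, f g = f .α + (f .a + (f .b + (f .c + (f .β + f .γ)))) := by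
  change Finset.sum {.α, .a, .b, .c, .β, .γ} f = _
  rw [Finset.sum_insert (by decide), Finset.sum_insert (by decide), Finset.sum_insert (by decide),
    Finset.sum_insert (by decide), Finset.sum_insert (by decide), Finset.sum_singleton]

variable (K : Type) [Field K]

/-- The arrow `g` as an element of `Λ`. -/
def aD (g : QD) : ΛD K := arrEl K (Fin 3) QD sD tD ρD g

theorem eD_mul_eD (i j : Fin 3) : eD K i * eD K j = if i = j then eD K i else 0 := by
  have h := RingQuot.mkAlgHom_rel K (PARel.vert (K := K) (s := sD) (t := tD) (ρ := ρD) i j)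
  rw [map_mul] at h
  rw [eD, eD, vtxEl, vtxEl, h]
  split_ifs <;> simp

theorem sum_eD : ∑ i, eD K i = 1 := by
  have h := RingQuot.mkAlgHom_rel K (PARel.one (K := K) (s := sD) (t := tD) (ρ := ρD))
  rw [map_sum, map_one] at h
  exact h

theorem eD_mul_aD (i : Fin 3) (g : QD) : eD K i * aD K g = if i = sD g then aD K g else 0 := by
  have h := RingQuot.mkAlgHom_rel K (PARel.src (K := K) (s := sD) (t := tD) (ρ := ρD) g i)
  rw [map_mul] at h
  rw [eD, aD, vtxEl, arrEl, h]
  split_ifs <;> simp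

theorem aD_mul_eD (g : QD) (i : Fin 3) : aD K g * eD K i = if i = tD g then aD K g else 0 := by
  have h := RingQuot.mkAlgHom_rel K (PARel.tgt (K := K) (s := sD) (t := tD) (ρ := ρD) g i)
  rw [map_mul] at h
  rw [eD, aD, vtxEl, arrEl, h]
  split_ifs <;> simp

theorem aD_mul_aD_of_mem {g h : QD} (H : [g, h] ∈ ρD) : aD K g * aD K h = 0 := by
  have h := RingQuot.mkAlgHom_rel K (PARel.rel (K := K) (s := sD) (t := tD) (ρ := ρD) _ H)
  rw [List.map_cons, List.map_singleton, List.prod_cons, List.prod_singleton, map_mul,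
    map_zero] at h
  exact h

theorem aD_mul_aD_of_ne {g h : QD} (H : sD h ≠ tD g) : aD K g * aD K h = 0 := by
  have h1 : aD K g * eD K (tD g) = aD K g := by simp [aD_mul_eD]
  rw [← h1, mul_assoc, eD_mul_aD, if_neg (Ne.symm H), mul_zero]

/-- The position of an arrow in the longest nonzero paths `γbαaβ` and `γcαaβ`. -/
def QD.height : QD → ℕ
  | .γ => 0 | .b => 1 | .c => 1 | .α => 2 | .a => 3 | .β => 4

theorem aD_mul_aD {g h : QD} (H : ¬h.height = g.height + 1) : aD K g * aD K h = 0 := by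
  cases g <;> cases h <;> first
    | exact absurd rfl H
    | exact aD_mul_aD_of_ne K (by decide)
    | exact aD_mul_aD_of_mem K (by simp [ρD])

theorem aD_mul_aD_mul {g h : QD} (H : ¬h.height = g.height + 1) (x : ΛD K) :
    aD K g * (aD K h * x) = 0 := by
  rw [← mul_assoc, aD_mul_aD K H, zero_mul]

theorem eD_mul_aD_mul (i : Fin 3) (g : QD) (x : ΛD K) :
    eD K i * (aD K g * x) = if i = sD g then aD K g * x else 0 := by
  rw [← mul_assoc, eD_mul_aD]; split_ifs <;> simp

theorem aD_mul_eD_mul (i : Fin 3) (g : QD) (x : ΛD K) :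
    aD K g * (eD K i * x) = if i = tD g then aD K g * x else 0 := by
  rw [← mul_assoc, aD_mul_eD]; split_ifs <;> simp

variable {K}

theorem ΛD.induction {p : ΛD K → Prop} (smul : ∀ (k : K) x, p x → p (k • x)) (one : p 1)
    (vert : ∀ i, p (eD K i)) (arr : ∀ g, p (aD K g)) (add : ∀ x y, p x → p y → p (x + y))
    (mul : ∀ x y, p x → p y → p (x * y)) (x : ΛD K) : p x := by
  obtain ⟨x, rfl⟩ := RingQuot.mkAlgHom_surjective K _ x
  induction x using FreeAlgebra.induction with
  | grade0 r =>
    rw [Algebra.algebraMap_eq_smul_one, map_smul, map_one]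
    exact smul _ _ one
  | grade1 x =>
    cases x with
    | vert i => exact vert i
    | arr g => exact arr g
  | mul a b ha hb => rw [map_mul]; exact mul _ _ ha hb
  | add a b ha hb => rw [map_add]; exact add _ _ ha hb

theorem exists_left_decomposition (x : ΛD K) : ∃ (s : Fin 3 → K) (q : QD → ΛD K),
    x = ∑ i, s i • eD K i + ∑ g, q g * aD K g := by
  suffices H : ∀ x y : ΛD K,
      (∃ (s : Fin 3 → K) (q : QD → ΛD K), y = ∑ i, s i • eD K i + ∑ g, q g * aD K g) →
      ∃ (s : Fin 3 → K) (q : QD → ΛD K), x * y = ∑ i, s i • eD K i + ∑ g, q g * aD K g by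
    simpa using H x 1 ⟨fun _ => 1, 0, by simp [sum_eD]⟩
  intro x
  induction x using ΛD.induction with
  | smul k x hx =>
    intro y hy
    obtain ⟨s, q, h⟩ := hx y hy
    refine ⟨k • s, k • q, ?_⟩
    rw [smul_mul_assoc, h]
    simp [Finset.smul_sum, smul_smul]
  | one => simp
  | vert j =>
    rintro y ⟨s, q, rfl⟩
    refine ⟨fun i => if j = i then s i else 0, fun g => eD K j * q g, ?_⟩
    simp [mul_add, Finset.mul_sum, eD_mul_eD, mul_assoc]
  | arr h =>
    rintro y ⟨s, q, rfl⟩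
    refine ⟨0, fun g => aD K h * q g + if g = h then s (tD h) • 1 else 0, ?_⟩
    simp [mul_add, add_mul, Finset.mul_sum, aD_mul_eD, mul_assoc, Finset.sum_add_distrib,
      ite_mul, add_comm]
  | add x x' hx hx' =>
    intro y hy
    obtain ⟨s, q, h⟩ := hx y hy
    obtain ⟨s', q', h'⟩ := hx' y hy
    refine ⟨s + s', q + q', ?_⟩
    simp only [add_mul, h, h', Pi.add_apply, add_smul, Finset.sum_add_distrib]
    abel
  | mul x x' hx hx' =>
    intro y hy
    rw [mul_assoc]
    exact hx _ (hx' _ hy)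

theorem exists_right_decomposition (x : ΛD K) : ∃ (s : Fin 3 → K) (q : QD → ΛD K),
    x = ∑ i, s i • eD K i + ∑ g, aD K g * q g := by
  suffices H : ∀ x y : ΛD K,
      (∃ (s : Fin 3 → K) (q : QD → ΛD K), y = ∑ i, s i • eD K i + ∑ g, aD K g * q g) →
      ∃ (s : Fin 3 → K) (q : QD → ΛD K), y * x = ∑ i, s i • eD K i + ∑ g, aD K g * q g by
    simpa using H x 1 ⟨fun _ => 1, 0, by simp [sum_eD]⟩
  intro x
  induction x using ΛD.induction with
  | smul k x hx =>
    intro y hy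
    obtain ⟨s, q, h⟩ := hx y hy
    refine ⟨k • s, k • q, ?_⟩
    rw [mul_smul_comm, h]
    simp [Finset.smul_sum, smul_smul]
  | one => simp
  | vert j =>
    rintro y ⟨s, q, rfl⟩
    refine ⟨fun i => if i = j then s i else 0, fun g => q g * eD K j, ?_⟩
    simp [add_mul, Finset.sum_mul, eD_mul_eD, mul_assoc]
  | arr h =>
    rintro y ⟨s, q, rfl⟩
    refine ⟨0, fun g => q g * aD K h + if g = h then s (sD h) • 1 else 0, ?_⟩
    simp [mul_add, add_mul, Finset.sum_mul, eD_mul_aD, mul_assoc, Finset.sum_add_distrib,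
      mul_ite, add_comm]
  | add x x' hx hx' =>
    intro y hy
    obtain ⟨s, q, h⟩ := hx y hy
    obtain ⟨s', q', h'⟩ := hx' y hy
    refine ⟨s + s', q + q', ?_⟩
    simp only [mul_add, h, h', Pi.add_apply, add_smul, Finset.sum_add_distrib]
    abel
  | mul x x' hx hx' =>
    intro y hy
    rw [← mul_assoc]
    exact hx' _ (hx _ hy)

/-! ### A faithful matrix representation -/

/-- The `0`-`1` matrix of a partial function. -/
def partialMatrix (K : Type) [Field K] (f : Fin 8 → Option (Fin 8)) :
    Matrix (Fin 8) (Fin 8) K :=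
  Matrix.of fun i j => if f i = some j then 1 else 0

theorem partialMatrix_mul_apply (f : Fin 8 → Option (Fin 8)) (M : Matrix (Fin 8) (Fin 8) K)
    (i j : Fin 8) : (partialMatrix K f * M) i j = (f i).elim 0 fun k => M k j := by
  rw [Matrix.mul_apply]
  cases h : f i <;> simp [partialMatrix, h]

theorem partialMatrix_mul (f g : Fin 8 → Option (Fin 8)) :
    partialMatrix K f * partialMatrix K g = partialMatrix K fun i => (f i).bind g := by
  ext i j
  rw [partialMatrix_mul_apply]
  cases h : f i <;> simp [partialMatrix, h]

theorem partialMatrix_none : partialMatrix K (fun _ => none) = 0 := by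
  ext i j
  simp [partialMatrix]

/-- The starting vertices of the paths `γbαaβ, γcαaβ, bαaβ, cαaβ, αaβ, aβ, β, e_2`, which form a
basis of `Λ e_2`. -/
def nodeVertex : Fin 8 → Fin 3 := ![2, 2, 1, 1, 0, 0, 1, 2]

/-- The action of the vertices and arrows on the path basis of `D(Λ e_2)`. -/
def nodeStep : PAGen (Fin 3) QD → Fin 8 → Option (Fin 8)
  | .vert v, i => if nodeVertex i = v then some i else none
  | .arr .γ, i => if i = 0 then some 2 else if i = 1 then some 3 else none
  | .arr .b, i => if i = 2 then some 4 else none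
  | .arr .c, i => if i = 3 then some 4 else none
  | .arr .α, i => if i = 4 then some 5 else none
  | .arr .a, i => if i = 5 then some 6 else none
  | .arr .β, i => if i = 6 then some 7 else none

theorem nodeStep_rel ⦃x y : FreeAlgebra K (PAGen (Fin 3) QD)⦄
    (h : PARel K (Fin 3) QD sD tD ρD x y) :
    FreeAlgebra.lift K (fun g => partialMatrix K (nodeStep g)) x =
      FreeAlgebra.lift K (fun g => partialMatrix K (nodeStep g)) y := by
  have key : ∀ g h f, (∀ i, (nodeStep g i).bind (nodeStep h) = f i) →
      partialMatrix K (nodeStep g) * partialMatrix K (nodeStep h) = partialMatrix K f :=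
    fun g h f H => by rw [partialMatrix_mul, funext H]
  cases h with
  | vert i j =>
    rw [map_mul, FreeAlgebra.lift_ι_apply, FreeAlgebra.lift_ι_apply]
    split_ifs with h
    · subst h
      rw [FreeAlgebra.lift_ι_apply]
      exact key _ _ _ (by revert i; decide)
    · rw [map_zero, ← partialMatrix_none]
      exact key _ _ _ (by revert i j; decide)
  | one =>
    rw [map_sum, map_one]
    simp only [FreeAlgebra.lift_ι_apply]
    ext i j
    rw [Matrix.sum_apply, Matrix.one_apply]
    simp only [partialMatrix, Matrix.of_apply, nodeStep]
    rw [Finset.sum_eq_single (nodeVertex i) (fun v _ hv => by simp [hv.symm]) (by simp)]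
    simp
  | src g i =>
    rw [map_mul, FreeAlgebra.lift_ι_apply, FreeAlgebra.lift_ι_apply]
    split_ifs with h
    · subst h
      rw [FreeAlgebra.lift_ι_apply]
      exact key _ _ _ (by cases g <;> decide)
    · rw [map_zero, ← partialMatrix_none]
      exact key _ _ _ (by revert i; cases g <;> decide)
  | tgt g i =>
    rw [map_mul, FreeAlgebra.lift_ι_apply, FreeAlgebra.lift_ι_apply]
    split_ifs with h
    · subst h
      rw [FreeAlgebra.lift_ι_apply]
      exact key _ _ _ (by cases g <;> decide)
    · rw [map_zero, ← partialMatrix_none]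
      exact key _ _ _ (by revert i; cases g <;> decide)
  | rel p hp =>
    simp only [ρD, Set.mem_insert_iff, Set.mem_singleton_iff] at hp
    rw [map_zero, ← partialMatrix_none]
    rcases hp with rfl | rfl | rfl | rfl | rfl | rfl | rfl <;>
      (rw [List.map_cons, List.map_singleton, List.prod_cons, List.prod_singleton, map_mul];
        simp only [FreeAlgebra.lift_ι_apply]; exact key _ _ _ (by decide))

/-- The representation of `Λ` by `8 × 8` matrices afforded by `Λ e_2`. -/
def matRep (K : Type) [Field K] : ΛD K →ₐ[K] Matrix (Fin 8) (Fin 8) K :=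
  RingQuot.liftAlgHom K ⟨FreeAlgebra.lift K fun g => partialMatrix K (nodeStep g), nodeStep_rel⟩

theorem matRep_eD (i : Fin 3) : matRep K (eD K i) = partialMatrix K (nodeStep (.vert i)) := by
  rw [matRep, eD, vtxEl, RingQuot.liftAlgHom_mkAlgHom_apply, FreeAlgebra.lift_ι_apply]

theorem matRep_aD (g : QD) : matRep K (aD K g) = partialMatrix K (nodeStep (.arr g)) := by
  rw [matRep, aD, arrEl, RingQuot.liftAlgHom_mkAlgHom_apply, FreeAlgebra.lift_ι_apply]

theorem matRep_eD_mul (v : Fin 3) (x : ΛD K) (i j : Fin 8) :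
    matRep K (eD K v * x) i j = if nodeVertex i = v then matRep K x i j else 0 := by
  rw [map_mul, matRep_eD, partialMatrix_mul_apply]
  simp only [nodeStep]
  split_ifs <;> rfl

theorem matRep_aD_mul (g : QD) (x : ΛD K) (i j : Fin 8) :
    matRep K (aD K g * x) i j = (nodeStep (.arr g) i).elim 0 fun k => matRep K x k j := by
  rw [map_mul, matRep_aD, partialMatrix_mul_apply]

theorem matRep_eD_apply (v : Fin 3) (i j : Fin 8) :
    matRep K (eD K v) i j = if nodeVertex i = v ∧ i = j then 1 else 0 := by
  rw [matRep_eD]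
  simp only [partialMatrix, nodeStep, Matrix.of_apply]
  by_cases h : nodeVertex i = v <;> simp [h]

theorem matRep_aD_apply (g : QD) (i j : Fin 8) :
    matRep K (aD K g) i j = if nodeStep (.arr g) i = some j then 1 else 0 := by
  rw [matRep_aD]
  rfl

/-! ### Annihilators of arrows -/

theorem mul_eD_zero (p : ΛD K) : ∃ (s : K) (x y z : ΛD K),
    p * eD K 0 = s • eD K 0 + x * aD K .α + y * aD K .b + z * aD K .c := by
  obtain ⟨s, q, rfl⟩ := exists_left_decomposition p
  refine ⟨s 0, q .α, q .b, q .c, ?_⟩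
  simp [add_mul, Fin.sum_univ_three, QD.sum_eq, eD_mul_eD, aD_mul_eD, mul_assoc, tD, add_assoc]

theorem mul_eD_one (p : ΛD K) : ∃ (s : K) (x y : ΛD K),
    p * eD K 1 = s • eD K 1 + x * aD K .a + y * aD K .γ := by
  obtain ⟨s, q, rfl⟩ := exists_left_decomposition p
  refine ⟨s 1, q .a, q .γ, ?_⟩
  simp [add_mul, Fin.sum_univ_three, QD.sum_eq, eD_mul_eD, aD_mul_eD, mul_assoc, tD, add_assoc]

theorem mul_eD_two (p : ΛD K) : ∃ (s : K) (x : ΛD K),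
    p * eD K 2 = s • eD K 2 + x * aD K .β := by
  obtain ⟨s, q, rfl⟩ := exists_left_decomposition p
  refine ⟨s 2, q .β, ?_⟩
  simp [add_mul, Fin.sum_univ_three, QD.sum_eq, eD_mul_eD, aD_mul_eD, mul_assoc, tD]

theorem eD_zero_mul (p : ΛD K) : ∃ (s : K) (x y : ΛD K),
    eD K 0 * p = s • eD K 0 + aD K .α * x + aD K .a * y := by
  obtain ⟨s, q, rfl⟩ := exists_right_decomposition p
  refine ⟨s 0, q .α, q .a, ?_⟩
  simp [mul_add, Fin.sum_univ_three, QD.sum_eq, eD_mul_eD, eD_mul_aD_mul, sD, add_assoc]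

theorem eD_one_mul (p : ΛD K) : ∃ (s : K) (x y z : ΛD K),
    eD K 1 * p = s • eD K 1 + aD K .b * x + aD K .c * y + aD K .β * z := by
  obtain ⟨s, q, rfl⟩ := exists_right_decomposition p
  refine ⟨s 1, q .b, q .c, q .β, ?_⟩
  simp [mul_add, Fin.sum_univ_three, QD.sum_eq, eD_mul_eD, eD_mul_aD_mul, sD, add_assoc]

theorem eD_two_mul (p : ΛD K) : ∃ (s : K) (x : ΛD K),
    eD K 2 * p = s • eD K 2 + aD K .γ * x := by
  obtain ⟨s, q, rfl⟩ := exists_right_decomposition p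
  refine ⟨s 2, q .γ, ?_⟩
  simp [mul_add, Fin.sum_univ_three, QD.sum_eq, eD_mul_eD, eD_mul_aD_mul, sD]

theorem mul_gamma (p : ΛD K) : ∃ s : K, p * aD K .γ = s • aD K .γ := by
  obtain ⟨s, x, h⟩ := mul_eD_two p
  refine ⟨s, ?_⟩
  have : p * aD K .γ = p * eD K 2 * aD K .γ := by simp [mul_assoc, eD_mul_aD, sD]
  rw [this, h]
  simp [add_mul, mul_assoc, eD_mul_aD, sD, aD_mul_aD, QD.height]

theorem mul_eD_one' (p : ΛD K) : ∃ (s t : K) (x : ΛD K),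
    p * eD K 1 = s • eD K 1 + t • aD K .γ + x * aD K .a := by
  obtain ⟨s, x, y, h⟩ := mul_eD_one p
  obtain ⟨t, ht⟩ := mul_gamma y
  exact ⟨s, t, x, by rw [h, ht]; abel⟩

theorem beta_mul (p : ΛD K) : ∃ s : K, aD K .β * p = s • aD K .β := by
  obtain ⟨s, x, h⟩ := eD_two_mul p
  refine ⟨s, ?_⟩
  have : aD K .β * p = aD K .β * (eD K 2 * p) := by simp [aD_mul_eD_mul, tD]
  rw [this, h]
  simp [mul_add, aD_mul_eD, tD, aD_mul_aD_mul, QD.height]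

theorem eD_one_mul' (p : ΛD K) : ∃ (s t : K) (x y : ΛD K),
    eD K 1 * p = s • eD K 1 + aD K .b * x + aD K .c * y + t • aD K .β := by
  obtain ⟨s, x, y, z, h⟩ := eD_one_mul p
  obtain ⟨t, ht⟩ := beta_mul z
  exact ⟨s, t, x, y, by rw [h, ht]⟩

theorem a_mul (p : ΛD K) : ∃ s t : K,
    aD K .a * p = s • aD K .a + t • (aD K .a * aD K .β) := by
  obtain ⟨s, t, x, y, h⟩ := eD_one_mul' p
  refine ⟨s, t, ?_⟩
  have : aD K .a * p = aD K .a * (eD K 1 * p) := by simp [aD_mul_eD_mul, tD]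
  rw [this, h]
  simp [mul_add, aD_mul_eD, tD, aD_mul_aD_mul, QD.height]

theorem alpha_mul (p : ΛD K) : ∃ s t u : K, aD K .α * p =
    s • aD K .α + t • (aD K .α * aD K .a) + u • (aD K .α * (aD K .a * aD K .β)) := by
  obtain ⟨s, x, y, h⟩ := eD_zero_mul p
  obtain ⟨t, u, h'⟩ := a_mul y
  refine ⟨s, t, u, ?_⟩
  have : aD K .α * p = aD K .α * (eD K 0 * p) := by simp [aD_mul_eD_mul, tD]
  rw [this, h, h']
  simp [mul_add, aD_mul_eD, tD, aD_mul_aD_mul, QD.height, add_assoc]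

theorem eD_zero_mul' (p : ΛD K) : ∃ (s t u v : K) (x : ΛD K), eD K 0 * p =
    s • eD K 0 + t • aD K .α + u • (aD K .α * aD K .a) + v • (aD K .α * (aD K .a * aD K .β))
      + aD K .a * x := by
  obtain ⟨s, x, y, h⟩ := eD_zero_mul p
  obtain ⟨t, u, v, h'⟩ := alpha_mul x
  exact ⟨s, t, u, v, y, by rw [h, h']; abel⟩

theorem mul_b_add_mul_c_eq_zero {p q : ΛD K} (h : p * aD K .b + q * aD K .c = 0) :
    (∃ x, p * eD K 1 = x * aD K .a) ∧ ∃ x, q * eD K 1 = x * aD K .a := by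
  obtain ⟨s, t, x, hp⟩ := mul_eD_one' p
  obtain ⟨s', t', x', hq⟩ := mul_eD_one' q
  have h1 : p * aD K .b = p * eD K 1 * aD K .b := by simp [mul_assoc, eD_mul_aD, sD]
  have h2 : q * aD K .c = q * eD K 1 * aD K .c := by simp [mul_assoc, eD_mul_aD, sD]
  rw [h1, h2, hp, hq] at h
  simp [add_mul, mul_assoc, eD_mul_aD, sD, aD_mul_aD, QD.height] at h
  have H := fun i => congrFun (congrFun (congrArg (matRep K) h) i) 4
  simp only [map_add, map_smul, map_zero, Matrix.add_apply, Matrix.smul_apply, matRep_aD_mul,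
    matRep_aD_apply, nodeStep, Matrix.zero_apply] at H
  have hs := H 2
  have ht := H 0
  have hs' := H 3
  have ht' := H 1
  simp at hs ht hs' ht'
  subst hs ht hs' ht'
  exact ⟨⟨x, by simpa using hp⟩, ⟨x', by simpa using hq⟩⟩

theorem mul_alpha (p : ΛD K) : ∃ s t u v w : K, p * aD K .α = s • aD K .α +
    t • (aD K .b * aD K .α) + u • (aD K .γ * (aD K .b * aD K .α)) +
    v • (aD K .c * aD K .α) + w • (aD K .γ * (aD K .c * aD K .α)) := by
  obtain ⟨s, x, y, z, h⟩ := mul_eD_zero p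
  obtain ⟨t, u, y', hy⟩ := mul_eD_one' y
  obtain ⟨v, w, z', hz⟩ := mul_eD_one' z
  refine ⟨s, t, u, v, w, ?_⟩
  have h1 : p * aD K .α = p * eD K 0 * aD K .α := by simp [mul_assoc, eD_mul_aD, sD]
  have h2 : y * (aD K .b * aD K .α) = y * eD K 1 * (aD K .b * aD K .α) := by
    simp [mul_assoc, eD_mul_aD_mul, sD]
  have h3 : z * (aD K .c * aD K .α) = z * eD K 1 * (aD K .c * aD K .α) := by
    simp [mul_assoc, eD_mul_aD_mul, sD]
  rw [h1, h]
  simp only [add_mul, mul_assoc]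
  rw [h2, h3, hy, hz]
  simp [add_mul, mul_assoc, eD_mul_aD, eD_mul_aD_mul, sD, aD_mul_aD, aD_mul_aD_mul, QD.height,
    add_assoc]

theorem mul_a_eq_zero {p : ΛD K} (h : p * aD K .a = 0) :
    ∃ x y, p * eD K 0 = x * aD K .b + y * aD K .c := by
  obtain ⟨s, x, y, z, hp⟩ := mul_eD_zero p
  obtain ⟨s', t, u, v, w, hx⟩ := mul_alpha x
  refine ⟨y, z, ?_⟩
  have h1 : p * aD K .a = p * eD K 0 * aD K .a := by simp [mul_assoc, eD_mul_aD, sD]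
  rw [h1, hp, hx] at h
  simp only [add_mul, mul_assoc, smul_mul_assoc] at h
  simp [eD_mul_aD, sD, aD_mul_aD, QD.height] at h
  have H := fun i => congrFun (congrFun (congrArg (matRep K) h) i) 6
  simp only [map_add, map_smul, map_zero, Matrix.add_apply, Matrix.smul_apply, matRep_aD_mul,
    matRep_aD_apply, nodeStep, Matrix.zero_apply] at H
  have h0 := H 0
  have h1 := H 1
  have h2 := H 2
  have h3 := H 3
  have h4 := H 4
  have h5 := H 5
  simp at h0 h1 h2 h3 h4 h5
  subst h0 h1 h2 h3 h4 h5
  rw [hp, hx]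
  simp

theorem matRep_four_apply_of_lt (p : ΛD K) {j : Fin 8} (hj : j < 4) : matRep K p 4 j = 0 := by
  obtain ⟨s, t, u, v, x, h⟩ := eD_zero_mul' p
  have H := congrFun (congrFun (congrArg (matRep K) h) 4) j
  simp only [map_add, map_smul, Matrix.add_apply, Matrix.smul_apply, matRep_aD_mul,
    matRep_eD_mul, matRep_eD_apply, matRep_aD_apply, nodeStep] at H
  revert hj H
  fin_cases j <;> simp [nodeVertex]

theorem exists_eD_zero_mul_eq {p : ΛD K} (hp : ∀ j, matRep K p 4 j = 0) :
    ∃ x, eD K 0 * p = aD K .a * x := by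
  obtain ⟨s, t, u, v, x, h⟩ := eD_zero_mul' p
  have H := fun j => congrFun (congrFun (congrArg (matRep K) h) 4) j
  simp only [map_add, map_smul, Matrix.add_apply, Matrix.smul_apply, matRep_aD_mul,
    matRep_eD_mul, matRep_eD_apply, matRep_aD_apply, nodeStep, hp] at H
  have h4 := H 4
  have h5 := H 5
  have h6 := H 6
  have h7 := H 7
  simp [nodeVertex] at h4 h5 h6 h7
  subst h4 h5 h6 h7
  exact ⟨x, by simpa using h⟩

theorem b_mul_add_c_mul_eq_zero {p q : ΛD K} (h : aD K .b * p + aD K .c * q = 0) :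
    (∃ x, eD K 0 * p = aD K .a * x) ∧ ∃ x, eD K 0 * q = aD K .a * x := by
  have H := fun i j => congrFun (congrFun (congrArg (matRep K) h) i) j
  simp only [map_add, Matrix.add_apply, map_zero, Matrix.zero_apply, matRep_aD_mul,
    nodeStep] at H
  exact ⟨exists_eD_zero_mul_eq fun j => by simpa using H 2 j,
    exists_eD_zero_mul_eq fun j => by simpa using H 3 j⟩

theorem a_mul_eq_zero {p : ΛD K} (h : aD K .a * p = 0) :
    ∃ x y, eD K 1 * p = aD K .b * x + aD K .c * y := by
  obtain ⟨s, t, x, y, hp⟩ := eD_one_mul' p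
  have h1 : aD K .a * p = aD K .a * (eD K 1 * p) := by simp [aD_mul_eD_mul, tD]
  rw [h1, hp] at h
  simp [mul_add, aD_mul_eD, tD, aD_mul_aD_mul, QD.height] at h
  have H := fun j => congrFun (congrFun (congrArg (matRep K) h) 5) j
  simp only [map_add, map_smul, map_zero, Matrix.add_apply, Matrix.smul_apply, matRep_aD_mul,
    matRep_aD_apply, nodeStep, Matrix.zero_apply] at H
  have h6 := H 6
  have h7 := H 7
  simp at h6 h7
  subst h6 h7
  exact ⟨x, y, by simpa using hp⟩

/-! ### Left modules of finite injective dimension -/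

/-- The vanishing of `Ext¹(Λa, N)` and `Ext¹(Λb, N)`, expressed in terms of elements. -/
def ExtVanishing (K : Type) [Field K] (N : Type) [AddCommGroup N] [Module (ΛD K) N] : Prop :=
  (∀ y z : N, eD K 1 • y = y → eD K 1 • z = z → aD K .a • y = 0 → aD K .a • z = 0 →
    ∃ x : N, aD K .b • x = y ∧ aD K .c • x = z) ∧
  ∀ x : N, eD K 0 • x = x → aD K .b • x = 0 → aD K .c • x = 0 → ∃ y : N, aD K .a • y = x

theorem Module.Injective.exists_comp_eq {R I A B : Type} [Ring R] [AddCommGroup I] [Module R I]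
    [AddCommGroup A] [Module R A] [AddCommGroup B] [Module R B] (hI : Module.Injective R I)
    (f : A →ₗ[R] B) (g : A →ₗ[R] I) (h : LinearMap.ker f ≤ LinearMap.ker g) :
    ∃ k : B →ₗ[R] I, ∀ x, k (f x) = g x := by
  obtain ⟨k, hk⟩ := hI.out ((LinearMap.ker f).liftQ f le_rfl)
    (LinearMap.ker_eq_bot.mp (Submodule.ker_liftQ_eq_bot _ _ _ le_rfl))
    ((LinearMap.ker f).liftQ g h)
  exact ⟨k, fun x => by simpa using hk (Submodule.Quotient.mk x)⟩

theorem ExtVanishing.of_injective {N : Type} [AddCommGroup N] [Module (ΛD K) N]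
    (hN : Module.Injective (ΛD K) N) : ExtVanishing K N := by
  constructor
  · intro y z hy hz hay haz
    obtain ⟨k, hk⟩ := hN.exists_comp_eq
      ((LinearMap.toSpanSingleton (ΛD K) _ (aD K .b)).coprod
        (LinearMap.toSpanSingleton (ΛD K) _ (aD K .c)))
      ((LinearMap.toSpanSingleton (ΛD K) _ y).coprod (LinearMap.toSpanSingleton (ΛD K) _ z)) (by
        rintro ⟨p, q⟩ hpq
        have hpq' : p * aD K .b + q * aD K .c = 0 := by simpa using hpq
        obtain ⟨⟨x, hx⟩, x', hx'⟩ := mul_b_add_mul_c_eq_zero hpq'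
        have h1 : p • y = 0 := by rw [← hy, smul_smul, hx, mul_smul, hay, smul_zero]
        have h2 : q • z = 0 := by rw [← hz, smul_smul, hx', mul_smul, haz, smul_zero]
        simp [h1, h2])
    refine ⟨k 1, ?_, ?_⟩
    · simpa [← map_smul] using hk (1, 0)
    · simpa [← map_smul] using hk (0, 1)
  · intro x hx hb hc
    obtain ⟨k, hk⟩ := hN.exists_comp_eq
      (LinearMap.toSpanSingleton (ΛD K) _ (aD K .a)) (LinearMap.toSpanSingleton (ΛD K) _ x) (by
        intro p hp
        have hp' : p * aD K .a = 0 := by simpa using hp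
        obtain ⟨y, z, h⟩ := mul_a_eq_zero hp'
        have h1 : p • x = 0 := by
          rw [← hx, smul_smul, h, add_smul, mul_smul, mul_smul, hb, hc, smul_zero, smul_zero,
            add_zero]
        simp [h1])
    exact ⟨k 1, by simpa [← map_smul] using hk 1⟩

theorem ExtVanishing.of_quotient {N I : Type} [AddCommGroup N] [Module (ΛD K) N]
    [AddCommGroup I] [Module (ΛD K) I] (f : N →ₗ[ΛD K] I) (hf : Function.Injective f)
    (hI : ExtVanishing K I) (hC : ExtVanishing K (I ⧸ LinearMap.range f)) :
    ExtVanishing K N := by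
  have hba : aD K .b * aD K .a = 0 := aD_mul_aD K (by decide)
  have hca : aD K .c * aD K .a = 0 := aD_mul_aD K (by decide)
  have hab : aD K .a * aD K .b = 0 := aD_mul_aD K (by decide)
  have hbe : aD K .b * eD K 0 = aD K .b := by simp [aD_mul_eD, tD]
  have hce : aD K .c * eD K 0 = aD K .c := by simp [aD_mul_eD, tD]
  have hae : aD K .a * eD K 1 = aD K .a := by simp [aD_mul_eD, tD]
  have hee : ∀ i, eD K i * eD K i = eD K i := by simp [eD_mul_eD]
  constructor
  · intro y z hy hz hay haz
    obtain ⟨x, hxy, hxz⟩ := hI.1 (f y) (f z) (by rw [← map_smul, hy]) (by rw [← map_smul, hz])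
      (by rw [← map_smul, hay, map_zero]) (by rw [← map_smul, haz, map_zero])
    obtain ⟨w, hw⟩ := hC.2 (Submodule.Quotient.mk (eD K 0 • x))
      (by rw [← Submodule.Quotient.mk_smul, smul_smul, hee])
      (by
        rw [← Submodule.Quotient.mk_smul, smul_smul, hbe, hxy]
        exact (Submodule.Quotient.mk_eq_zero _).mpr ⟨y, rfl⟩)
      (by
        rw [← Submodule.Quotient.mk_smul, smul_smul, hce, hxz]
        exact (Submodule.Quotient.mk_eq_zero _).mpr ⟨z, rfl⟩)
    obtain ⟨w, rfl⟩ := Submodule.Quotient.mk_surjective _ w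
    rw [← Submodule.Quotient.mk_smul, eq_comm, Submodule.Quotient.eq] at hw
    obtain ⟨n, hn⟩ := hw
    refine ⟨n, hf ?_, hf ?_⟩
    · rw [map_smul, hn, smul_sub, smul_smul, smul_smul, hbe, hba, zero_smul, sub_zero, hxy]
    · rw [map_smul, hn, smul_sub, smul_smul, smul_smul, hce, hca, zero_smul, sub_zero, hxz]
  · intro x hx hb hc
    obtain ⟨y, hy⟩ := hI.2 (f x) (by rw [← map_smul, hx]) (by rw [← map_smul, hb, map_zero])
      (by rw [← map_smul, hc, map_zero])
    obtain ⟨w, hw, -⟩ := hC.1 (Submodule.Quotient.mk (eD K 1 • y)) 0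
      (by rw [← Submodule.Quotient.mk_smul, smul_smul, hee]) (smul_zero _)
      (by
        rw [← Submodule.Quotient.mk_smul, smul_smul, hae, hy]
        exact (Submodule.Quotient.mk_eq_zero _).mpr ⟨x, rfl⟩)
      (smul_zero _)
    obtain ⟨w, rfl⟩ := Submodule.Quotient.mk_surjective _ w
    rw [← Submodule.Quotient.mk_smul, eq_comm, Submodule.Quotient.eq] at hw
    obtain ⟨n, hn⟩ := hw
    refine ⟨n, hf ?_⟩
    rw [map_smul, hn, smul_sub, smul_smul, smul_smul, hae, hab, zero_smul, sub_zero, hy]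

theorem InjDimLE.extVanishing {n : ℕ} {N : ModuleCat.{0} (ΛD K)} (h : InjDimLE (ΛD K) n N) :
    ExtVanishing K N := by
  induction n generalizing N with
  | zero => exact .of_injective h
  | succ n ih =>
    obtain ⟨I, f, hI, hf, hC⟩ := h
    exact .of_quotient f hf (.of_injective hI) (ih hC)

theorem not_extVanishing_of_injective {N : Type} [AddCommGroup N] [Module (ΛD K) N]
    (f : N →ₗ[ΛD K] ΛD K) (hf : Function.Injective f) (y : N)
    (hy : f y = aD K .b * (aD K .α * (aD K .a * aD K .β))) : ¬ ExtVanishing K N := by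
  intro h
  obtain ⟨x, hb, hc⟩ := h.1 y 0
    (hf (by rw [map_smul, hy, smul_eq_mul, eD_mul_aD_mul]; rfl)) (smul_zero _)
    (hf (by rw [map_smul, hy, smul_eq_mul, aD_mul_aD_mul K (by decide), map_zero])) (smul_zero _)
  have h1 := congrFun (congrFun (congrArg (fun n => matRep K (f n)) hb) 2) 7
  have h2 := congrFun (congrFun (congrArg (fun n => matRep K (f n)) hc) 3) 7
  simp only [map_smul, smul_eq_mul, hy, map_zero, matRep_aD_mul, matRep_aD_apply, nodeStep,
    Matrix.zero_apply] at h1 h2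
  simp at h1 h2
  rw [h1] at h2
  exact one_ne_zero h2

theorem not_injDimLE_eLD (n : ℕ) : ¬ InjDimLE (ΛD K) n (ModuleCat.of (ΛD K) (eLD K 2)) := by
  intro h
  refine not_extVanishing_of_injective (eLD K 2).subtype (Submodule.subtype_injective _)
    ⟨aD K .b * (aD K .α * (aD K .a * aD K .β)), ?_⟩ rfl h.extVanishing
  exact Submodule.mem_span_singleton.mpr ⟨aD K .b * (aD K .α * (aD K .a * aD K .β)), by
    simp [mul_assoc, aD_mul_eD, tD]⟩

theorem not_injDimLE_self (n : ℕ) : ¬ InjDimLE (ΛD K) n (ModuleCat.of (ΛD K) (ΛD K)) :=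
  fun h => not_extVanishing_of_injective LinearMap.id Function.injective_id _ rfl h.extVanishing

/-! ### The injective right module at the vertex `3` -/

/-- The basis of `Λ e_2` consisting of paths. -/
def nodePath (K : Type) [Field K] : Fin 8 → ΛD K :=
  ![aD K .γ * (aD K .b * (aD K .α * (aD K .a * aD K .β))),
    aD K .γ * (aD K .c * (aD K .α * (aD K .a * aD K .β))),
    aD K .b * (aD K .α * (aD K .a * aD K .β)), aD K .c * (aD K .α * (aD K .a * aD K .β)),
    aD K .α * (aD K .a * aD K .β), aD K .a * aD K .β, aD K .β, eD K 2]

theorem mul_nodePath (x : ΛD K) (j : Fin 8) :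
    x * nodePath K j = ∑ k, matRep K x k j • nodePath K k := by
  induction x using ΛD.induction generalizing j with
  | smul s x hx => simp [hx, Finset.smul_sum, smul_smul]
  | one => simp [Matrix.one_apply]
  | vert i =>
    simp only [matRep_eD_apply]
    fin_cases i <;> fin_cases j <;>
      simp [nodePath, Fin.sum_univ_eight, nodeVertex, eD_mul_eD, eD_mul_aD, eD_mul_aD_mul, sD]
  | arr g =>
    simp only [matRep_aD_apply]
    cases g <;> fin_cases j <;>
      simp [nodePath, Fin.sum_univ_eight, nodeStep, aD_mul_eD, aD_mul_aD, aD_mul_aD_mul,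
        QD.height, tD]
  | add x y hx hy => simp [add_mul, hx, hy, add_smul, Finset.sum_add_distrib]
  | mul x y hx hy =>
    rw [mul_assoc, hy, Finset.mul_sum]
    simp only [mul_smul_comm, hx, Finset.smul_sum, smul_smul, map_mul, Matrix.mul_apply,
      Finset.sum_smul]
    rw [Finset.sum_comm]
    simp only [mul_comm]

theorem matRep_nodePath_seven (j k : Fin 8) :
    matRep K (nodePath K j) k 7 = if k = j then 1 else 0 := by
  fin_cases j <;> fin_cases k <;>
    simp [nodePath, matRep_aD_mul, matRep_aD_apply, matRep_eD_apply, nodeStep, nodeVertex]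

theorem matRep_nodePath_of_ne {j k l : Fin 8} (hj : ¬j = 7) (hl : ¬l = 7) :
    matRep K (nodePath K j) k l = 0 := by
  revert hj hl
  fin_cases j <;> fin_cases k <;> fin_cases l <;>
    simp [nodePath, matRep_aD_mul, matRep_aD_apply, nodeStep]

theorem matRep_seven_apply (x : ΛD K) {j : Fin 8} (hj : ¬j = 7) : matRep K x 7 j = 0 := by
  obtain ⟨s, q, rfl⟩ := exists_right_decomposition x
  simp only [map_add, map_sum, map_smul, Matrix.add_apply, Matrix.sum_apply, Matrix.smul_apply,
    matRep_eD_apply, matRep_aD_mul]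
  simp [QD.sum_eq, nodeStep, Ne.symm hj]

/-- The right `Λ`-module dual to `Λ e_2`. -/
abbrev DualE (K : Type) [Field K] : Type := Fin 8 → K

instance : Module (ΛD K)ᵐᵒᵖ (DualE K) where
  smul r v := Matrix.vecMul v (matRep K r.unop)
  one_smul v := by
    change Matrix.vecMul v (matRep K 1) = v
    rw [map_one, Matrix.vecMul_one]
  mul_smul r s v := by
    change Matrix.vecMul v (matRep K (s.unop * r.unop)) =
      Matrix.vecMul (Matrix.vecMul v (matRep K s.unop)) (matRep K r.unop)
    rw [map_mul, Matrix.vecMul_vecMul]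
  smul_zero r := Matrix.zero_vecMul _
  smul_add r v w := Matrix.add_vecMul _ _ _
  add_smul r s v := by
    change Matrix.vecMul v (matRep K (r.unop + s.unop)) =
      Matrix.vecMul v (matRep K r.unop) + Matrix.vecMul v (matRep K s.unop)
    rw [map_add, Matrix.vecMul_add]
  zero_smul v := by
    change Matrix.vecMul v (matRep K 0) = 0
    rw [map_zero, Matrix.vecMul_zero]

theorem DualE.smul_apply (r : (ΛD K)ᵐᵒᵖ) (v : DualE K) (j : Fin 8) :
    (r • v) j = ∑ k, v k * matRep K r.unop k j := rfl

theorem DualE.nodePath_smul_seven (v : DualE K) (j : Fin 8) :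
    (MulOpposite.op (nodePath K j) • v) 7 = v j := by
  simp [DualE.smul_apply, matRep_nodePath_seven]

theorem DualE.injective : Module.Injective (ΛD K)ᵐᵒᵖ (DualE K) := by
  refine Module.Baer.injective fun I g => ?_
  obtain ⟨l, hl⟩ := LinearMap.exists_extend (p := I.restrictScalars K)
    { toFun := fun x => g x 7
      map_add' := fun x y => by
        exact congrFun (map_add g x y) 7
      map_smul' := fun s x => by
        have : s • x = algebraMap K (ΛD K)ᵐᵒᵖ s • (show I from x) :=
          Subtype.ext (Algebra.smul_def s _)
        rw [this, map_smul, DualE.smul_apply]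
        simp [Matrix.algebraMap_matrix_apply, mul_comm] }
  replace hl : ∀ (x) (hx : x ∈ I), l x = g ⟨x, hx⟩ 7 := fun x hx =>
    LinearMap.congr_fun hl ⟨x, hx⟩
  refine ⟨LinearMap.toSpanSingleton _ _ (fun j => l (MulOpposite.op (nodePath K j)) : DualE K),
    fun x hx => ?_⟩
  funext j
  rw [LinearMap.toSpanSingleton_apply, DualE.smul_apply, ← DualE.nodePath_smul_seven (g _),
    ← map_smul]
  change _ = g ⟨MulOpposite.op (nodePath K j) * x, I.mul_mem_left _ hx⟩ 7
  rw [← hl, ← MulOpposite.op_unop x, ← MulOpposite.op_mul, mul_nodePath, Finset.op_sum,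
    map_sum]
  simp [mul_comm]

/-- The socle of `DualE K`. -/
def DualE.socle (K : Type) [Field K] : Submodule (ΛD K)ᵐᵒᵖ (DualE K) where
  carrier := {v | ∀ j, ¬j = 7 → v j = 0}
  add_mem' hv hw j hj := by rw [Pi.add_apply, hv j hj, hw j hj, add_zero]
  zero_mem' _ _ := rfl
  smul_mem' r v hv j hj := by
    rw [DualE.smul_apply]
    refine Finset.sum_eq_zero fun k _ => ?_
    by_cases hk : k = 7
    · rw [hk, matRep_seven_apply _ hj, mul_zero]
    · rw [hv k hk, zero_mul]

theorem DualE.isEssentialSub_socle : IsEssentialSub (DualE.socle K) := by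
  intro N hN
  obtain ⟨v, hv, hv0⟩ := N.exists_mem_ne_zero_of_ne_bot hN
  by_cases h : v ∈ DualE.socle K
  · exact Submodule.ne_bot_iff _ |>.mpr ⟨v, ⟨h, hv⟩, hv0⟩
  · obtain ⟨j, hj, hvj⟩ : ∃ j, ¬j = 7 ∧ ¬v j = 0 := by
      by_contra! H
      exact h H
    refine Submodule.ne_bot_iff _ |>.mpr
      ⟨MulOpposite.op (nodePath K j) • v, ⟨fun l hl => ?_, N.smul_mem _ hv⟩, fun h0 => hvj ?_⟩
    · rw [DualE.smul_apply]
      exact Finset.sum_eq_zero fun k _ => by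
        rw [MulOpposite.unop_op, matRep_nodePath_of_ne hj hl, mul_zero]
    · rw [← DualE.nodePath_smul_seven v j, h0, Pi.zero_apply]

theorem DualE.isSimpleAt_socle : IsSimpleAt (ΛD K) (eD K 2) (DualE.socle K) := by
  have hu : (Pi.single 7 1 : Fin 8 → K) ∈ DualE.socle K := fun j hj => Pi.single_eq_of_ne hj 1
  have hu0 : (⟨_, hu⟩ : DualE.socle K) ≠ 0 := fun h => one_ne_zero
    (by simpa using congrFun (congrArg Subtype.val h) 7 : (1 : K) = 0)
  refine ⟨?_, ⟨_, hu⟩, hu0, Subtype.ext (funext fun j => ?_)⟩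
  · rw [isSimpleModule_iff_isAtom]
    refine ⟨(Submodule.ne_bot_iff _).mpr ⟨_, hu, fun h => hu0 (Subtype.ext h)⟩,
      fun N hN => by_contra fun hN0 => hN.not_ge fun w hw => ?_⟩
    obtain ⟨v, hv, hv0⟩ := N.exists_mem_ne_zero_of_ne_bot hN0
    have hv7 : v 7 ≠ 0 := fun h => hv0 (funext fun j => by
      by_cases hj : j = 7
      · rw [hj, h]; rfl
      · exact hN.le hv j hj)
    have : w = algebraMap K (ΛD K)ᵐᵒᵖ (w 7 / v 7) • v := by
      funext j
      rw [DualE.smul_apply, MulOpposite.algebraMap_apply, MulOpposite.unop_op, AlgHom.commutes]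
      by_cases hj : j = 7
      · subst hj
        simp [Matrix.algebraMap_matrix_apply, mul_div_cancel₀ _ hv7]
      · simp [Matrix.algebraMap_matrix_apply, hw j hj, hN.le hv j hj]
    rw [this]
    exact N.smul_mem _ hv
  · change (MulOpposite.op (eD K 2) • (Pi.single 7 1 : DualE K)) j = (Pi.single 7 1 : Fin 8 → K) j
    rw [DualE.smul_apply, MulOpposite.unop_op]
    simp only [matRep_eD_apply]
    fin_cases j <;> simp [Fin.sum_univ_eight, nodeVertex]

theorem DualE.isInjEnvAt : IsInjEnvAt (ΛD K) (eD K 2) (DualE K) :=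
  ⟨DualE.injective, _, DualE.isEssentialSub_socle, DualE.isSimpleAt_socle⟩

open MulOpposite (op)

/-! ### Right modules of finite projective dimension -/

/-- The vanishing of `Tor₁(M, Λb + Λc)` and `Tor₁(M, Λa)`, expressed in terms of elements. -/
def TorVanishing (K : Type) [Field K] (M : Type) [AddCommGroup M] [Module (ΛD K)ᵐᵒᵖ M] : Prop :=
  (∀ y z : M, op (eD K 1) • y = y → op (eD K 1) • z = z →
    op (aD K .b) • y + op (aD K .c) • z = 0 →
    (∃ m : M, op (aD K .a) • m = y) ∧ ∃ m : M, op (aD K .a) • m = z) ∧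
  ∀ x : M, op (eD K 0) • x = x → op (aD K .a) • x = 0 →
    ∃ y z : M, op (aD K .b) • y + op (aD K .c) • z = x

theorem TorVanishing.of_projective {M : Type} [AddCommGroup M] [Module (ΛD K)ᵐᵒᵖ M]
    (hM : Module.Projective (ΛD K)ᵐᵒᵖ M) : TorVanishing K M := by
  obtain ⟨s, hs⟩ := hM.out
  have lift : ∀ (r : (ΛD K)ᵐᵒᵖ) (x : M), r • x = x → (∀ p, ∃ q, r * s x p = op (aD K .a) * q) →
      ∃ m : M, op (aD K .a) • m = x := by
    intro r x hx h
    choose q hq using h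
    refine ⟨∑ p ∈ (s x).support, q p • p, ?_⟩
    conv_rhs => rw [← hx, ← hs x, Finsupp.linearCombination_apply, Finsupp.sum]
    simp only [Finset.smul_sum, smul_smul, hq]
    rfl
  constructor
  · intro y z hy hz h
    have H : ∀ p, (s y p).unop * aD K .b + (s z p).unop * aD K .c = 0 := fun p => by
      simpa using congrArg MulOpposite.unop (DFunLike.congr_fun (congrArg s h) p)
    exact ⟨lift _ y hy fun p => by
        obtain ⟨q, hq⟩ := (mul_b_add_mul_c_eq_zero (H p)).1
        exact ⟨op q, MulOpposite.unop_injective hq⟩,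
      lift _ z hz fun p => by
        obtain ⟨q, hq⟩ := (mul_b_add_mul_c_eq_zero (H p)).2
        exact ⟨op q, MulOpposite.unop_injective hq⟩⟩
  · intro x hx h
    have H : ∀ p, (s x p).unop * aD K .a = 0 := fun p => by
      simpa using congrArg MulOpposite.unop (DFunLike.congr_fun (congrArg s h) p)
    choose u v huv using fun p => mul_a_eq_zero (H p)
    refine ⟨∑ p ∈ (s x).support, op (u p) • p, ∑ p ∈ (s x).support, op (v p) • p, ?_⟩
    conv_rhs => rw [← hx, ← hs x, Finsupp.linearCombination_apply, Finsupp.sum]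
    simp only [Finset.smul_sum, smul_smul, ← Finset.sum_add_distrib, ← add_smul]
    exact Finset.sum_congr rfl fun p _ => congrArg (· • p)
      (MulOpposite.unop_injective (huv p).symm)

theorem TorVanishing.of_surjective {P M : Type} [AddCommGroup P] [Module (ΛD K)ᵐᵒᵖ P]
    [AddCommGroup M] [Module (ΛD K)ᵐᵒᵖ M] (f : P →ₗ[(ΛD K)ᵐᵒᵖ] M) (hf : Function.Surjective f)
    (hP : TorVanishing K P) (hN : TorVanishing K (LinearMap.ker f)) : TorVanishing K M := by
  have hba : aD K .b * aD K .a = 0 := aD_mul_aD K (by decide)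
  have hca : aD K .c * aD K .a = 0 := aD_mul_aD K (by decide)
  have hab : aD K .a * aD K .b = 0 := aD_mul_aD K (by decide)
  have hbe : aD K .b * eD K 0 = aD K .b := by simp [aD_mul_eD, tD]
  have hce : aD K .c * eD K 0 = aD K .c := by simp [aD_mul_eD, tD]
  have hae : aD K .a * eD K 1 = aD K .a := by simp [aD_mul_eD, tD]
  have hee : ∀ i, eD K i * eD K i = eD K i := by simp [eD_mul_eD]
  have heb : eD K 1 * aD K .b = aD K .b := by simp [eD_mul_aD, sD]
  have hec : eD K 1 * aD K .c = aD K .c := by simp [eD_mul_aD, sD]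
  have hea : eD K 0 * aD K .a = aD K .a := by simp [eD_mul_aD, sD]
  have lift : ∀ i (x : M), op (eD K i) • x = x → ∃ p : P, op (eD K i) • p = p ∧ f p = x := by
    intro i x hx
    obtain ⟨p, hp⟩ := hf x
    exact ⟨op (eD K i) • p, by rw [smul_smul, ← MulOpposite.op_mul, hee],
      by rw [map_smul, hp, hx]⟩
  constructor
  · intro y z hy hz h
    obtain ⟨y, hye, rfl⟩ := lift 1 y hy
    obtain ⟨z, hze, rfl⟩ := lift 1 z hz
    rw [← map_smul, ← map_smul, ← map_add] at h
    obtain ⟨⟨y', hy'⟩, ⟨z', hz'⟩, hyz⟩ := hN.2 ⟨_, h⟩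
      (Subtype.ext (by
        change op (eD K 0) • (_ + _) = _
        rw [smul_add, smul_smul, smul_smul, ← MulOpposite.op_mul, ← MulOpposite.op_mul,
          hbe, hce]))
      (Subtype.ext (by
        change op (aD K .a) • (_ + _) = 0
        rw [smul_add, smul_smul, smul_smul, ← MulOpposite.op_mul, ← MulOpposite.op_mul, hba, hca,
          MulOpposite.op_zero, zero_smul, zero_smul, add_zero]))
    replace hyz : op (aD K .b) • y' + op (aD K .c) • z' = op (aD K .b) • y + op (aD K .c) • z :=
      congrArg Subtype.val hyz
    obtain ⟨⟨m, hm⟩, n, hn⟩ := hP.1 (y - op (eD K 1) • y') (z - op (eD K 1) • z')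
      (by rw [smul_sub, hye, smul_smul, ← MulOpposite.op_mul, hee])
      (by rw [smul_sub, hze, smul_smul, ← MulOpposite.op_mul, hee])
      (by
        rw [smul_sub, smul_sub, smul_smul, smul_smul, ← MulOpposite.op_mul, ← MulOpposite.op_mul,
          heb, hec, sub_add_sub_comm, hyz, sub_self])
    refine ⟨⟨f m, ?_⟩, f n, ?_⟩
    · rw [← map_smul, hm, map_sub, map_smul, LinearMap.mem_ker.mp hy', smul_zero, sub_zero]
    · rw [← map_smul, hn, map_sub, map_smul, LinearMap.mem_ker.mp hz', smul_zero, sub_zero]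
  · intro x hx h
    obtain ⟨x, hxe, rfl⟩ := lift 0 x hx
    rw [← map_smul] at h
    obtain ⟨⟨⟨m, hm⟩, hmx⟩, -⟩ := hN.1 ⟨_, h⟩ 0
      (Subtype.ext (by
        change op (eD K 1) • (op (aD K .a) • x) = _
        rw [smul_smul, ← MulOpposite.op_mul, hae])) (smul_zero _)
      (Subtype.ext (by
        change op (aD K .b) • (op (aD K .a) • x) + op (aD K .c) • (0 : P) = 0
        rw [smul_smul, ← MulOpposite.op_mul, hab, MulOpposite.op_zero, zero_smul, smul_zero,
          add_zero]))
    replace hmx : op (aD K .a) • m = op (aD K .a) • x := congrArg Subtype.val hmx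
    obtain ⟨y, z, hyz⟩ := hP.2 (x - op (eD K 0) • m)
      (by rw [smul_sub, hxe, smul_smul, ← MulOpposite.op_mul, hee])
      (by rw [smul_sub, smul_smul, ← MulOpposite.op_mul, hea, hmx, sub_self])
    refine ⟨f y, f z, ?_⟩
    rw [← map_smul, ← map_smul, ← map_add, hyz, map_sub, map_smul, LinearMap.mem_ker.mp hm,
      smul_zero, sub_zero]

theorem ProjDimLE.torVanishing {n : ℕ} {M : ModuleCat.{0} (ΛD K)ᵐᵒᵖ}
    (h : ProjDimLE (ΛD K)ᵐᵒᵖ n M) : TorVanishing K M := by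
  induction n generalizing M with
  | zero => exact .of_projective h
  | succ n ih =>
    obtain ⟨P, f, hP, hf, hN⟩ := h
    exact .of_surjective f hf (.of_projective hP) (ih hN)

theorem not_projDimLE_dualE (n : ℕ) :
    ¬ ProjDimLE (ΛD K)ᵐᵒᵖ n (ModuleCat.of (ΛD K)ᵐᵒᵖ (DualE K)) := by
  intro h
  obtain ⟨⟨m, hm⟩, -⟩ := h.torVanishing.1 (Pi.single 2 1 : DualE K) (-Pi.single 3 1 : DualE K)
    (by
      funext j
      rw [DualE.smul_apply]
      simp only [MulOpposite.unop_op, matRep_eD_apply]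
      fin_cases j <;> simp [Fin.sum_univ_eight, nodeVertex])
    (by
      funext j
      rw [DualE.smul_apply]
      simp only [MulOpposite.unop_op, matRep_eD_apply]
      fin_cases j <;> simp [Fin.sum_univ_eight, nodeVertex])
    (by
      funext j
      change (_ • _ : DualE K) j + (_ • _ : DualE K) j = 0
      rw [DualE.smul_apply, DualE.smul_apply]
      simp only [MulOpposite.unop_op, matRep_aD_apply]
      fin_cases j <;> simp [nodeStep])
  have := congrFun hm 2
  change (_ • (m : DualE K)) 2 = _ at this
  rw [DualE.smul_apply] at this
  simp [matRep_aD_apply, nodeStep] at this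

/-! ### Projective right ideals and superfluous submodules -/

theorem mem_eRD {i : Fin 3} {x : ΛD K} : x ∈ eRD K i ↔ eD K i * x = x := by
  rw [eRD, Submodule.mem_span_singleton]
  constructor
  · rintro ⟨r, rfl⟩
    change eD K i * (eD K i * r.unop) = eD K i * r.unop
    rw [← mul_assoc, eD_mul_eD, if_pos rfl]
  · exact fun h => ⟨op x, h⟩

theorem eD_mul_coe {i : Fin 3} (x : eRD K i) : eD K i * (x : ΛD K) = x := mem_eRD.mp x.2

theorem eD_mul_mem (i : Fin 3) (x : ΛD K) : eD K i * x ∈ eRD K i :=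
  mem_eRD.mpr (by rw [← mul_assoc, eD_mul_eD, if_pos rfl])

instance (i : Fin 3) : Module.Projective (ΛD K)ᵐᵒᵖ (eRD K i) :=
  Module.Projective.of_split (M := (ΛD K)ᵐᵒᵖ)
    { toFun := fun x => op x
      map_add' := fun _ _ => rfl
      map_smul' := fun _ _ => rfl }
    (LinearMap.toSpanSingleton _ _ ⟨eD K i, mem_eRD.mpr (by rw [eD_mul_eD, if_pos rfl])⟩)
    (LinearMap.ext fun x => Subtype.ext (eD_mul_coe x))

/-- Left multiplication by an arrow `g : i → j`, as a map `e_jΛ → e_iΛ`. -/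
def arrowMul (K : Type) [Field K] (g : QD) {i j : Fin 3} (hi : i = sD g) :
    eRD K j →ₗ[(ΛD K)ᵐᵒᵖ] eRD K i where
  toFun x := ⟨aD K g * x, mem_eRD.mpr (by rw [eD_mul_aD_mul, if_pos hi])⟩
  map_add' x y := Subtype.ext (mul_add _ _ _)
  map_smul' r x := Subtype.ext (mul_assoc (aD K g) x r.unop).symm

theorem superfluous_of_forall_eq_sum {M : Type} [AddCommGroup M] [Module (ΛD K)ᵐᵒᵖ M]
    {N : Submodule (ΛD K)ᵐᵒᵖ M} (hN : ∀ n ∈ N, ∃ m : QD → M, n = ∑ g, op (aD K g) • m g) :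
    Superfluous N := by
  intro X hX
  have split : ∀ m : M, ∃ x ∈ X, ∃ w : QD → M, x + ∑ g, op (aD K g) • w g = m := by
    intro m
    obtain ⟨x, hx, n, hn, rfl⟩ := Submodule.mem_sup.mp (hX ▸ Submodule.mem_top : m ∈ X ⊔ N)
    obtain ⟨w, rfl⟩ := hN n hn
    exact ⟨x, hx, w, rfl⟩
  have key : ∀ (k : ℕ) (h : QD), h.height = k → ∀ m : M, op (aD K h) • m ∈ X := by
    intro k
    induction k using Nat.strong_induction_on with
    | _ k ih =>
      rintro h rfl m
      obtain ⟨x, hx, w, rfl⟩ := split m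
      rw [smul_add, Finset.smul_sum]
      refine X.add_mem (X.smul_mem _ hx) (X.sum_mem fun g _ => ?_)
      by_cases hg : h.height = g.height + 1
      · exact X.smul_mem _ (ih _ (by rw [hg]; exact Nat.lt_succ_self _) g rfl _)
      · rw [smul_smul, ← MulOpposite.op_mul, aD_mul_aD K hg, MulOpposite.op_zero, zero_smul]
        exact X.zero_mem
  refine (Submodule.eq_top_iff').mpr fun m => ?_
  obtain ⟨x, hx, w, rfl⟩ := split m
  exact X.add_mem hx (X.sum_mem fun g _ => key _ g rfl _)

/-- The left ideal of `Λ` generated by the arrows. -/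
def arrowIdeal (K : Type) [Field K] : Submodule (ΛD K) (ΛD K) :=
  Submodule.span (ΛD K) (Set.range (aD K))

theorem aD_mul_mem_arrowIdeal (g : QD) (x : ΛD K) : aD K g * x ∈ arrowIdeal K := by
  obtain ⟨s, q, rfl⟩ := exists_left_decomposition x
  have ha : ∀ y h, y * aD K h ∈ arrowIdeal K := fun y h =>
    Submodule.smul_mem _ y (Submodule.subset_span ⟨h, rfl⟩)
  rw [mul_add, Finset.mul_sum, Finset.mul_sum]
  refine Submodule.add_mem _ (Submodule.sum_mem _ fun i _ => ?_)
    (Submodule.sum_mem _ fun h _ => ?_)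
  · rw [mul_smul_comm, aD_mul_eD]
    split_ifs
    · simpa using ha (s i • 1) g
    · rw [smul_zero]
      exact Submodule.zero_mem _
  · rw [← mul_assoc]
    exact ha _ _

theorem superfluous_of_forall_mem {ι : Type} {i : Fin 3}
    {N : Submodule (ΛD K)ᵐᵒᵖ (ι → eRD K i)} (hN : ∀ n ∈ N, ∀ k, (n k : ΛD K) ∈ arrowIdeal K) :
    Superfluous (R := (ΛD K)ᵐᵒᵖ) (M := ι → eRD K i) N := by
  refine superfluous_of_forall_eq_sum fun n hn => ?_
  choose c hc using fun k => Submodule.mem_span_range_iff_exists_fun (ΛD K) |>.mp (hN n hn k)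
  refine ⟨fun g k => ⟨eD K i * c k g, eD_mul_mem i _⟩, funext fun k => Subtype.ext ?_⟩
  rw [← eD_mul_coe (n k), ← hc k, Finset.sum_apply, Submodule.coe_sum, Finset.mul_sum]
  exact Finset.sum_congr rfl fun g _ => (mul_assoc _ _ _).symm

/-! ### Splicing two alternating sequences of maps -/

/-- The sequence `A 0, B 0, A 1, B 1, …`. -/
def splice {R : Type} [Ring R] : (A B : ℕ → ModuleCat.{0} R) → ℕ → ModuleCat.{0} R
  | A, _, 0 => A 0
  | A, B, n + 1 => splice B (fun m => A (m + 1)) n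

/-- The sequence of maps `⋯ → B 1 → A 1 → B 0 → A 0`. -/
def spliceMap {R : Type} [Ring R] : (A B : ℕ → ModuleCat.{0} R) →
    (∀ m, B m →ₗ[R] A m) → (∀ m, A (m + 1) →ₗ[R] B m) →
    ∀ n, splice A B (n + 1) →ₗ[R] splice A B n
  | _, _, f, _, 0 => f 0
  | _, B, f, g, n + 1 => spliceMap B _ g (fun m => f (m + 1)) n

theorem splice_two_mul {R : Type} [Ring R] (A B : ℕ → ModuleCat.{0} R) (m : ℕ) :
    splice A B (2 * m) = A m := by
  induction m generalizing A B with
  | zero => rfl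
  | succ m ih => exact ih (fun m => A (m + 1)) fun m => B (m + 1)

theorem splice_two_mul_add_one {R : Type} [Ring R] (A B : ℕ → ModuleCat.{0} R) (m : ℕ) :
    splice A B (2 * m + 1) = B m :=
  splice_two_mul B (fun m => A (m + 1)) m

theorem splice_induction {R : Type} [Ring R] {p : ModuleCat.{0} R → Prop}
    {A B : ℕ → ModuleCat.{0} R} (hA : ∀ m, p (A m)) (hB : ∀ m, p (B m)) (n : ℕ) :
    p (splice A B n) := by
  induction n generalizing A B with
  | zero => exact hA 0
  | succ n ih => exact ih hB fun m => hA (m + 1)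

theorem superfluous_ker_spliceMap {R : Type} [Ring R] {A B : ℕ → ModuleCat.{0} R}
    {f : ∀ m, B m →ₗ[R] A m} {g : ∀ m, A (m + 1) →ₗ[R] B m}
    (hf : ∀ m, Superfluous (LinearMap.ker (f m))) (hg : ∀ m, Superfluous (LinearMap.ker (g m)))
    (n : ℕ) : Superfluous (LinearMap.ker (spliceMap A B f g n)) := by
  induction n generalizing A B with
  | zero => exact hf 0
  | succ n ih => exact ih hg fun m => hf (m + 1)

theorem exact_spliceMap {R : Type} [Ring R] {A B : ℕ → ModuleCat.{0} R}
    {f : ∀ m, B m →ₗ[R] A m} {g : ∀ m, A (m + 1) →ₗ[R] B m}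
    (hgf : ∀ m, Function.Exact (g m) (f m)) (hfg : ∀ m, Function.Exact (f (m + 1)) (g m))
    (n : ℕ) : Function.Exact (spliceMap A B f g (n + 1)) (spliceMap A B f g n) := by
  induction n generalizing A B with
  | zero => exact hgf 0
  | succ n ih => exact ih hfg fun m => hgf (m + 1)

/-! ### The minimal projective resolution -/

/-- The indices `(k, false)` and `(k, true)` in degree `m + 1` refine the index `k` in
degree `m`. -/
def branchEquiv (m : ℕ) : Fin (3 * 2 ^ m) × Bool ≃ Fin (3 * 2 ^ (m + 1)) :=
  Fintype.equivOfCardEq (by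
    rw [Fintype.card_prod, Fintype.card_fin, Fintype.card_bool, Fintype.card_fin]; ring)

/-- The projective modules `(e_1Λ)^{3·2^m}`. -/
abbrev oddTerm (K : Type) [Field K] (m : ℕ) : ModuleCat.{0} (ΛD K)ᵐᵒᵖ :=
  ModuleCat.of _ (Fin (3 * 2 ^ m) → eRD K 0)

/-- The projective modules `(e_2Λ)^{3·2^m}`. -/
abbrev evenTerm (K : Type) [Field K] (m : ℕ) : ModuleCat.{0} (ΛD K)ᵐᵒᵖ :=
  ModuleCat.of _ (Fin (3 * 2 ^ m) → eRD K 1)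

/-- Left multiplication by `a` on each component. -/
def evenMap (K : Type) [Field K] (m : ℕ) : evenTerm K m →ₗ[(ΛD K)ᵐᵒᵖ] oddTerm K m :=
  LinearMap.pi fun k => arrowMul K .a rfl ∘ₗ LinearMap.proj k

/-- Left multiplication by `(b, c)` on each pair of components. -/
def oddMap (K : Type) [Field K] (m : ℕ) : oddTerm K (m + 1) →ₗ[(ΛD K)ᵐᵒᵖ] evenTerm K m :=
  LinearMap.pi fun k =>
    arrowMul K .b rfl ∘ₗ LinearMap.proj (branchEquiv m (k, false)) +
      arrowMul K .c rfl ∘ₗ LinearMap.proj (branchEquiv m (k, true))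

/-- The map `(e_1Λ)^3 → (e_3Λ)^2` given by `(x, y, z) ↦ (γbx + γcy, γbz - γcx)`. -/
def initialMap (K : Type) [Field K] :
    (Fin 3 → eRD K 0) →ₗ[(ΛD K)ᵐᵒᵖ] (Fin 2 → eRD K 2) where
  toFun x := ![
    arrowMul K .γ (j := 1) rfl
      (arrowMul K .b (i := 1) rfl (x 0) + arrowMul K .c (i := 1) rfl (x 1)),
    arrowMul K .γ (j := 1) rfl
      (arrowMul K .b (i := 1) rfl (x 2) - arrowMul K .c (i := 1) rfl (x 0))]
  map_add' x y := by
    funext k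
    fin_cases k
    · refine (congrArg (arrowMul K .γ rfl) ?_).trans (map_add (arrowMul K .γ rfl) _ _)
      simp only [Pi.add_apply, map_add]
      abel
    · refine (congrArg (arrowMul K .γ rfl) ?_).trans (map_add (arrowMul K .γ rfl) _ _)
      simp only [Pi.add_apply, map_add]
      abel
  map_smul' r x := by
    funext k
    fin_cases k
    · refine (congrArg (arrowMul K .γ rfl) ?_).trans (map_smul (arrowMul K .γ rfl) r _)
      simp only [Pi.smul_apply, map_smul, smul_add]
    · refine (congrArg (arrowMul K .γ rfl) ?_).trans (map_smul (arrowMul K .γ rfl) r _)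
      simp only [Pi.smul_apply, map_smul]
      exact Subtype.ext (sub_mul _ _ r.unop).symm

/-- The projective cover of `DualE K`. -/
def coverMap (K : Type) [Field K] : (Fin 2 → eRD K 2) →ₗ[(ΛD K)ᵐᵒᵖ] DualE K where
  toFun p := op (p 0 : ΛD K) • (Pi.single 0 1 : DualE K) +
    op (p 1 : ΛD K) • (Pi.single 1 1 : DualE K)
  map_add' p q := by
    simp only [Pi.add_apply, Submodule.coe_add, MulOpposite.op_add, add_smul]
    abel
  map_smul' r p := by
    rw [RingHom.id_apply, smul_add, smul_smul, smul_smul]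
    rfl

theorem coverMap_apply (p : Fin 2 → eRD K 2) (j : Fin 8) :
    coverMap K p j = matRep K (p 0 : ΛD K) 0 j + matRep K (p 1 : ΛD K) 1 j := by
  change (_ • _ : DualE K) j + (_ • _ : DualE K) j = _
  rw [DualE.smul_apply, DualE.smul_apply]
  simp [Pi.single_apply]

theorem coe_evenMap (m : ℕ) (x : evenTerm K m) (k : Fin (3 * 2 ^ m)) :
    ((evenMap K m x k : eRD K 0) : ΛD K) = aD K .a * ((x k : eRD K 1) : ΛD K) := rfl

theorem coe_oddMap (m : ℕ) (x : oddTerm K (m + 1)) (k : Fin (3 * 2 ^ m)) :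
    ((oddMap K m x k : eRD K 1) : ΛD K) =
      aD K .b * ((x (branchEquiv m (k, false)) : eRD K 0) : ΛD K) +
        aD K .c * ((x (branchEquiv m (k, true)) : eRD K 0) : ΛD K) := rfl

theorem coe_initialMap_zero (x : Fin 3 → eRD K 0) :
    (initialMap K x 0 : ΛD K) = aD K .γ * (aD K .b * x 0 + aD K .c * x 1) := rfl

theorem coe_initialMap_one (x : Fin 3 → eRD K 0) :
    (initialMap K x 1 : ΛD K) = aD K .γ * (aD K .b * x 2 - aD K .c * x 0) := rfl

theorem exists_a_mul_of_oddMap_eq_zero {m : ℕ} {x : oddTerm K (m + 1)} (hx : oddMap K m x = 0)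
    (k : Fin (3 * 2 ^ (m + 1))) : ∃ u, ((x k : eRD K 0) : ΛD K) = aD K .a * u := by
  obtain ⟨⟨k, t⟩, rfl⟩ := (branchEquiv m).surjective k
  obtain ⟨h1, h2⟩ := b_mul_add_c_mul_eq_zero
    ((coe_oddMap m x k).symm.trans (congrArg Subtype.val (congrFun hx k)))
  rw [eD_mul_coe] at h1 h2
  cases t
  exacts [h1, h2]

theorem exists_b_mul_add_c_mul_of_evenMap_eq_zero {m : ℕ} {x : evenTerm K m}
    (hx : evenMap K m x = 0) (k : Fin (3 * 2 ^ m)) :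
    ∃ u v, ((x k : eRD K 1) : ΛD K) = aD K .b * u + aD K .c * v := by
  have := a_mul_eq_zero ((coe_evenMap m x k).symm.trans (congrArg Subtype.val (congrFun hx k)))
  rwa [eD_mul_coe] at this

theorem exact_evenMap_oddMap (m : ℕ) : Function.Exact (evenMap K (m + 1)) (oddMap K m) := by
  refine fun x => ⟨fun hx => ?_, ?_⟩
  · choose u hu using exists_a_mul_of_oddMap_eq_zero hx
    refine ⟨fun k => ⟨eD K 1 * u k, eD_mul_mem 1 _⟩, funext fun k => Subtype.ext ?_⟩
    rw [hu, coe_evenMap]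
    simp [aD_mul_eD_mul, tD]
  · rintro ⟨y, rfl⟩
    refine funext fun k => Subtype.ext ?_
    rw [coe_oddMap, coe_evenMap, coe_evenMap, aD_mul_aD_mul K (by decide),
      aD_mul_aD_mul K (by decide), add_zero]
    rfl

theorem exact_oddMap_evenMap (m : ℕ) : Function.Exact (oddMap K m) (evenMap K m) := by
  refine fun x => ⟨fun hx => ?_, ?_⟩
  · choose u v h using exists_b_mul_add_c_mul_of_evenMap_eq_zero hx
    refine ⟨fun k => ⟨eD K 0 * cond ((branchEquiv m).symm k).2 (v ((branchEquiv m).symm k).1)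
      (u ((branchEquiv m).symm k).1), eD_mul_mem 0 _⟩, funext fun k => Subtype.ext ?_⟩
    rw [h, coe_oddMap, Equiv.symm_apply_apply, Equiv.symm_apply_apply]
    simp [aD_mul_eD_mul, tD]
  · rintro ⟨y, rfl⟩
    refine funext fun k => Subtype.ext ?_
    rw [coe_evenMap, coe_oddMap, mul_add, aD_mul_aD_mul K (by decide),
      aD_mul_aD_mul K (by decide), add_zero]
    rfl

theorem eD_two_mul' (p : ΛD K) : ∃ (s t : K) (x y : ΛD K),
    eD K 2 * p = s • eD K 2 + t • aD K .γ + aD K .γ * (aD K .b * x + aD K .c * y) := by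
  obtain ⟨s, z, h⟩ := eD_two_mul p
  obtain ⟨t, u, x, y, h'⟩ := eD_one_mul' z
  refine ⟨s, t, x, y, ?_⟩
  have : aD K .γ * z = aD K .γ * (eD K 1 * z) := by simp [aD_mul_eD_mul, tD]
  rw [h, this, h']
  simp [mul_add, aD_mul_eD, tD, aD_mul_aD, QD.height, add_assoc]

theorem exists_of_coverMap_eq_zero {p : Fin 2 → eRD K 2} (hp : coverMap K p = 0) :
    ∃ x y z : ΛD K, (p 0 : ΛD K) = aD K .γ * (aD K .b * x + aD K .c * y) ∧
      (p 1 : ΛD K) = aD K .γ * (aD K .b * z - aD K .c * x) := by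
  obtain ⟨s, t, x, y, h0⟩ := eD_two_mul' (p 0 : ΛD K)
  obtain ⟨s', t', z, w, h1⟩ := eD_two_mul' (p 1 : ΛD K)
  rw [eD_mul_coe] at h0 h1
  have H : ∀ j, matRep K (p 0 : ΛD K) 0 j + matRep K (p 1 : ΛD K) 1 j = 0 := fun j => by
    rw [← coverMap_apply, hp, Pi.zero_apply]
  simp only [h0, h1, map_add, map_smul, mul_add, Matrix.add_apply, Matrix.smul_apply,
    matRep_aD_mul, matRep_eD_apply, matRep_aD_apply, nodeStep] at H
  have hx := fun {j} hj => matRep_four_apply_of_lt x (j := j) hj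
  have hw := fun {j} hj => matRep_four_apply_of_lt w (j := j) hj
  have H0 := H 0
  have H1 := H 1
  have H2 := H 2
  have H3 := H 3
  simp [nodeVertex, hx, hw] at H0 H1 H2 H3
  subst H0 H1 H2 H3
  obtain ⟨u, hu⟩ := exists_eD_zero_mul_eq (p := x + w) fun j => by simpa [nodeVertex] using H j
  have hc : aD K .c * (x + w) = 0 := by
    rw [← if_pos (c := (0 : Fin 3) = tD .c) rfl (t := aD K .c * (x + w)) (e := 0),
      ← aD_mul_eD_mul, hu, aD_mul_aD_mul K (by decide)]
  refine ⟨x, y, z, by simpa using h0, ?_⟩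
  rw [mul_add, add_eq_zero_iff_neg_eq] at hc
  rw [h1, ← hc]
  simp [sub_eq_add_neg]

theorem exact_initialMap_coverMap : Function.Exact (initialMap K) (coverMap K) := by
  refine fun p => ⟨fun hp => ?_, ?_⟩
  · obtain ⟨x, y, z, h0, h1⟩ := exists_of_coverMap_eq_zero hp
    refine ⟨fun k => ⟨eD K 0 * (![x, y, z] : Fin 3 → ΛD K) k, eD_mul_mem 0 _⟩,
      funext fun k => Subtype.ext ?_⟩
    fin_cases k
    · refine (coe_initialMap_zero _).trans (Eq.trans ?_ h0.symm)
      simp [aD_mul_eD_mul, tD]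
    · refine (coe_initialMap_one _).trans (Eq.trans ?_ h1.symm)
      simp [aD_mul_eD_mul, tD]
  · rintro ⟨x, rfl⟩
    funext j
    rw [coverMap_apply, coe_initialMap_zero, coe_initialMap_one, mul_add, mul_sub, map_add,
      map_sub]
    simp [matRep_aD_mul, nodeStep, -map_mul]

theorem gamma_mul_eq_zero {p q : ΛD K} (h : aD K .γ * (aD K .b * p + aD K .c * q) = 0) :
    (∃ x, eD K 0 * p = aD K .a * x) ∧ ∃ x, eD K 0 * q = aD K .a * x := by
  have H := fun i j => congrFun (congrFun (congrArg (matRep K) h) i) j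
  simp only [mul_add, map_add, Matrix.add_apply, map_zero, Matrix.zero_apply, matRep_aD_mul,
    nodeStep] at H
  exact ⟨exists_eD_zero_mul_eq fun j => by simpa using H 0 j,
    exists_eD_zero_mul_eq fun j => by simpa using H 1 j⟩

theorem exists_a_mul_of_initialMap_eq_zero {x : Fin 3 → eRD K 0} (hx : initialMap K x = 0)
    (k : Fin 3) : ∃ u, (x k : ΛD K) = aD K .a * u := by
  have h0 := (coe_initialMap_zero x).symm.trans (congrArg Subtype.val (congrFun hx 0))
  have h1 := (coe_initialMap_one x).symm.trans (congrArg Subtype.val (congrFun hx 1))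
  rw [sub_eq_add_neg, ← mul_neg (aD K .c)] at h1
  rw [← eD_mul_coe (x k)]
  fin_cases k
  exacts [(gamma_mul_eq_zero h0).1, (gamma_mul_eq_zero h0).2,
    (gamma_mul_eq_zero (q := -(x 0 : ΛD K)) h1).1]

theorem exact_evenMap_initialMap : Function.Exact (evenMap K 0) (initialMap K) := by
  refine fun x => ⟨fun hx => ?_, ?_⟩
  · choose u hu using exists_a_mul_of_initialMap_eq_zero hx
    refine ⟨fun k => ⟨eD K 1 * u k, eD_mul_mem 1 _⟩, funext fun k => Subtype.ext ?_⟩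
    refine (coe_evenMap 0 _ k).trans (Eq.trans ?_ (hu k).symm)
    simp [aD_mul_eD_mul, tD]
  · rintro ⟨y, rfl⟩
    have h : ∀ k : Fin 3, (evenMap K 0 y k : ΛD K) = aD K .a * (y k : eRD K 1) := coe_evenMap 0 y
    funext k
    refine Subtype.ext ?_
    fin_cases k
    · refine (coe_initialMap_zero _).trans ?_
      rw [h, h]
      simp [aD_mul_aD_mul, QD.height]
    · refine (coe_initialMap_one _).trans ?_
      rw [h, h]
      simp [aD_mul_aD_mul, QD.height]

theorem coverMap_surjective : Function.Surjective (coverMap K) := by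
  intro v
  refine ⟨fun k => ⟨eD K 2 * (![v 0 • 1 + v 2 • aD K .γ + v 4 • (aD K .γ * aD K .b) +
    v 5 • (aD K .γ * (aD K .b * aD K .α)) + v 6 • (aD K .γ * (aD K .b * (aD K .α * aD K .a))) +
    v 7 • nodePath K 0, v 1 • 1 + v 3 • aD K .γ] : Fin 2 → ΛD K) k, eD_mul_mem 2 _⟩, ?_⟩
  funext j
  rw [coverMap_apply]
  simp only [matRep_eD_mul]
  fin_cases j <;>
    simp [nodeVertex, matRep_aD_mul, matRep_aD_apply, nodeStep, nodePath, -map_mul]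

theorem superfluous_ker_coverMap :
    Superfluous (R := (ΛD K)ᵐᵒᵖ) (M := Fin 2 → eRD K 2) (LinearMap.ker (coverMap K)) :=
  superfluous_of_forall_mem fun p hp k => by
    obtain ⟨x, y, z, h0, h1⟩ := exists_of_coverMap_eq_zero hp
    fin_cases k
    · exact h0 ▸ aD_mul_mem_arrowIdeal _ _
    · exact h1 ▸ aD_mul_mem_arrowIdeal _ _

theorem superfluous_ker_initialMap :
    Superfluous (R := (ΛD K)ᵐᵒᵖ) (M := Fin 3 → eRD K 0) (LinearMap.ker (initialMap K)) :=
  superfluous_of_forall_mem fun p hp k => by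
    obtain ⟨u, hu⟩ := exists_a_mul_of_initialMap_eq_zero hp k
    exact hu ▸ aD_mul_mem_arrowIdeal _ _

theorem superfluous_ker_evenMap (m : ℕ) :
    Superfluous (R := (ΛD K)ᵐᵒᵖ) (M := evenTerm K m) (LinearMap.ker (evenMap K m)) :=
  superfluous_of_forall_mem fun p hp k => by
    obtain ⟨u, v, h⟩ := exists_b_mul_add_c_mul_of_evenMap_eq_zero hp k
    rw [h]
    exact Submodule.add_mem _ (aD_mul_mem_arrowIdeal _ _) (aD_mul_mem_arrowIdeal _ _)

theorem superfluous_ker_oddMap (m : ℕ) :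
    Superfluous (R := (ΛD K)ᵐᵒᵖ) (M := oddTerm K (m + 1)) (LinearMap.ker (oddMap K m)) :=
  superfluous_of_forall_mem fun p hp k => by
    obtain ⟨u, hu⟩ := exists_a_mul_of_oddMap_eq_zero hp k
    exact hu ▸ aD_mul_mem_arrowIdeal _ _

/-- The terms of the minimal projective resolution of `DualE K`. -/
def resolution (K : Type) [Field K] : ℕ → ModuleCat.{0} (ΛD K)ᵐᵒᵖ
  | 0 => ModuleCat.of _ (Fin 2 → eRD K 2)
  | n + 1 => splice (oddTerm K) (evenTerm K) n

/-- The differentials of the minimal projective resolution of `DualE K`. -/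
def resolutionMap (K : Type) [Field K] :
    ∀ n, resolution K (n + 1) →ₗ[(ΛD K)ᵐᵒᵖ] resolution K n
  | 0 => initialMap K
  | n + 1 => spliceMap (oddTerm K) (evenTerm K) (evenMap K) (oddMap K) n

instance {ι : Type} [Fintype ι] (i : Fin 3) :
    Module.Projective (ΛD K)ᵐᵒᵖ (ι → eRD K i) := by
  classical
  exact Module.Projective.of_equiv' (DFinsupp.linearEquivFunOnFintype (M := fun _ : ι => eRD K i))

theorem projective_resolution (n : ℕ) : Module.Projective (ΛD K)ᵐᵒᵖ (resolution K n) := by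
  cases n with
  | zero => exact inferInstanceAs (Module.Projective (ΛD K)ᵐᵒᵖ (Fin 2 → eRD K 2))
  | succ n =>
    exact splice_induction (p := fun M => Module.Projective (ΛD K)ᵐᵒᵖ M)
      (fun m => inferInstanceAs (Module.Projective (ΛD K)ᵐᵒᵖ (Fin (3 * 2 ^ m) → eRD K 0)))
      (fun m => inferInstanceAs (Module.Projective (ΛD K)ᵐᵒᵖ (Fin (3 * 2 ^ m) → eRD K 1))) n

theorem exact_resolutionMap (n : ℕ) :
    Function.Exact (resolutionMap K (n + 1)) (resolutionMap K n) := by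
  cases n with
  | zero => exact exact_evenMap_initialMap
  | succ n => exact exact_spliceMap exact_oddMap_evenMap exact_evenMap_oddMap n

theorem superfluous_ker_resolutionMap (n : ℕ) :
    Superfluous (LinearMap.ker (resolutionMap K n)) := by
  cases n with
  | zero => exact superfluous_ker_initialMap
  | succ n => exact superfluous_ker_spliceMap superfluous_ker_evenMap superfluous_ker_oddMap n

theorem nonempty_equiv_of_eq {M N : ModuleCat.{0} (ΛD K)ᵐᵒᵖ} (h : M = N) :
    Nonempty (M ≃ₗ[(ΛD K)ᵐᵒᵖ] N) := by
  subst h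
  exact ⟨LinearEquiv.refl _ _⟩

end

/-- **Example 3.3, failure of Gorensteinness.**  For `Λ = KQ/I` as above: the
indecomposable injective right `Λ`-module `I(3)` at the vertex `3` has a minimal
projective resolution `⋯ → U_3 → U_2 → U_1 → e_3Λ ⊕ e_3Λ → I(3) → 0` with
`U_{2m-1} = (e_1Λ)^{⊕ 3·2^{m-1}}` and `U_{2m} = (e_2Λ)^{⊕ 3·2^{m-1}}`; hence `I(3)` has
infinite projective dimension, the left module `Λe_3` has infinite injective dimension,
and `Λ` is not Gorenstein. -/
theorem statement16 {K : Type} [Field K] [IsAlgClosed K] (hchar : ringChar K ≠ 2) :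
    (∃ I3 : ModuleCat.{0} (ΛD K)ᵐᵒᵖ, IsInjEnvAt (ΛD K) (eD K 2) I3 ∧
      (∃ (P : ℕ → ModuleCat.{0} (ΛD K)ᵐᵒᵖ)
          (dm : ∀ n, P (n + 1) →ₗ[(ΛD K)ᵐᵒᵖ] P n) (ε : P 0 →ₗ[(ΛD K)ᵐᵒᵖ] I3),
        (∀ n, Module.Projective (ΛD K)ᵐᵒᵖ (P n)) ∧
        Function.Surjective ε ∧ Function.Exact (dm 0) ε ∧
        (∀ n, Function.Exact (dm (n + 1)) (dm n)) ∧
        Superfluous (LinearMap.ker ε) ∧ (∀ n, Superfluous (LinearMap.ker (dm n))) ∧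
        Nonempty ((P 0 : Type) ≃ₗ[(ΛD K)ᵐᵒᵖ] (↥(eRD K 2) × ↥(eRD K 2))) ∧
        (∀ m : ℕ,
          Nonempty ((P (2 * m + 1) : Type) ≃ₗ[(ΛD K)ᵐᵒᵖ] (Fin (3 * 2 ^ m) → ↥(eRD K 0))) ∧
          Nonempty ((P (2 * m + 2) : Type) ≃ₗ[(ΛD K)ᵐᵒᵖ] (Fin (3 * 2 ^ m) → ↥(eRD K 1))))) ∧
      ¬ ∃ n, ProjDimLE (ΛD K)ᵐᵒᵖ n I3) ∧
    (¬ ∃ n, InjDimLE (ΛD K) n (ModuleCat.of (ΛD K) ↥(eLD K 2))) ∧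
    ¬ IsGorenstein (ΛD K) := by
  refine ⟨⟨ModuleCat.of _ (DualE K), DualE.isInjEnvAt,
    ⟨resolution K, resolutionMap K, coverMap K, projective_resolution, coverMap_surjective,
      exact_initialMap_coverMap, exact_resolutionMap, superfluous_ker_coverMap,
      superfluous_ker_resolutionMap, ⟨LinearEquiv.finTwoArrow _ _⟩, fun m =>
        ⟨nonempty_equiv_of_eq (splice_two_mul _ _ m),
          nonempty_equiv_of_eq (splice_two_mul_add_one _ _ m)⟩⟩,
    fun ⟨n, h⟩ => not_projDimLE_dualE n h⟩, fun ⟨n, h⟩ => not_injDimLE_eLD n h,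
    fun h => h.1.elim not_injDimLE_self⟩
end
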